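/- Fix D = {d_1 < … < d_k} ⊆ [n−1] with d_0 = 0, d_{k+1} = n and I = [n−1] ∖ D; let c ∈ S_n be a standard Coxeter element of some parabolic subgroup with ℓ(w_0(I)c) = ℓ(w_0(I)) + ℓ(c) and I ⊆ J(w_0(I)c); let λ be a partition with at most n parts and γ ∈ Par_D. Let β ∈ P_{cλ,γ}, let i < j be in the same block and p < q be in the same block with (i,j) ≠ (p,q). If both t_{ij}β and t_{pq}β belong to P_{cλ,γ} and both cover β, then there exists β′ ∈ P_{cλ,γ} with t_{ij}β ≤ β′ and t_{pq}β ≤ β′. -/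

import Mathlib

open scoped Classical

namespace LSS

noncomputable section

open MvPolynomial

/-- The simple transposition `s_i ∈ S_n` (`1 ≤ i ≤ n-1`, 1-indexed): it exchanges the
letters `i` and `i+1` of `[n] = {1, …, n}`, realized on `Fin n` (0-indexed) as the swap
of `i-1` and `i`. For `i` out of range it is the identity. -/
def st (n : ℕ) (i : ℕ) : Equiv.Perm (Fin n) :=
  if h : 0 < i ∧ i < n then Equiv.swap ⟨i - 1, by omega⟩ ⟨i, h.2⟩ else 1

/-- Coxeter length of `w ∈ S_n` = number of inversions. -/
def len (n : ℕ) (w : Equiv.Perm (Fin n)) : ℕ :=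
  (Finset.univ.filter fun p : Fin n × Fin n => p.1 < p.2 ∧ w p.2 < w p.1).card

/-- `L` is a reduced word for `w`: a list of indices in `[n-1]` of length `ℓ(w)` whose
associated product of simple transpositions is `w`. -/
def IsRedWord (n : ℕ) (L : List ℕ) (w : Equiv.Perm (Fin n)) : Prop :=
  (∀ i ∈ L, 1 ≤ i ∧ i ≤ n - 1) ∧ (L.map (st n)).prod = w ∧ L.length = len n w

/-- The left descent set `J(w) = {j ∈ [n-1] : ℓ(s_j w) < ℓ(w)}`. -/
def Descents (n : ℕ) (w : Equiv.Perm (Fin n)) : Set ℕ :=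
  {j | 1 ≤ j ∧ j ≤ n - 1 ∧ len n (st n j * w) < len n w}

/-- The parabolic subgroup of `S_n` generated by `{s_i : i ∈ I}`. -/
def parab (n : ℕ) (I : Set ℕ) : Subgroup (Equiv.Perm (Fin n)) :=
  Subgroup.closure (st n '' I)

/-- `u = w_0(I)`, the longest element of the parabolic subgroup generated by `{s_i : i ∈ I}`. -/
def IsLongest (n : ℕ) (I : Set ℕ) (u : Equiv.Perm (Fin n)) : Prop :=
  u ∈ parab n I ∧ ∀ v ∈ parab n I, len n v ≤ len n u

/-- `c` is a standard Coxeter element of some parabolic subgroup of `S_n`: a product of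
the elements of some subset of `{s_1, …, s_{n-1}}`, each appearing exactly once, in some order. -/
def IsStdCox (n : ℕ) (c : Equiv.Perm (Fin n)) : Prop :=
  ∃ L : List ℕ, L.Nodup ∧ (∀ i ∈ L, 1 ≤ i ∧ i ≤ n - 1) ∧ (L.map (st n)).prod = c

/-- A weak composition `β : Fin n → ℕ` as an exponent vector. -/
def expOf (n : ℕ) (β : Fin n → ℕ) : Fin n →₀ ℕ := Finsupp.equivFunOnFinite.symm β

/-- The monomial `x^β = x_1^{β_1} ⋯ x_n^{β_n}`. -/
def mono (n : ℕ) (β : Fin n → ℕ) : MvPolynomial (Fin n) ℤ := monomial (expOf n β) 1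

/-- The coefficient `[x^β] f`. -/
def coeffOf (n : ℕ) (β : Fin n → ℕ) (f : MvPolynomial (Fin n) ℤ) : ℤ := coeff (expOf n β) f

/-- The isobaric divided difference (Demazure) operator
`π_i(f) = (x_i f − x_{i+1} s_i f)/(x_i − x_{i+1})` (1-indexed `i`), defined as the unique
polynomial `g` with `(x_i − x_{i+1})·g = x_i f − x_{i+1} s_i f`; such a `g` always exists
and is unique since `ℤ[x_1,…,x_n]` is a domain. -/
def dem (n : ℕ) (i : ℕ) (f : MvPolynomial (Fin n) ℤ) : MvPolynomial (Fin n) ℤ :=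
  if h : 0 < i ∧ i < n then
    if hg : ∃ g, (X (⟨i - 1, by omega⟩ : Fin n) - X (⟨i, h.2⟩ : Fin n)) * g =
        X (⟨i - 1, by omega⟩ : Fin n) * f -
          X (⟨i, h.2⟩ : Fin n) *
            rename (⇑(Equiv.swap (⟨i - 1, by omega⟩ : Fin n) (⟨i, h.2⟩ : Fin n))) f then
      hg.choose
    else 0
  else f

/-- `π_{i_1} π_{i_2} ⋯ π_{i_ℓ} (f)` for a word `L = [i_1, …, i_ℓ]`. -/
def demWord (n : ℕ) (L : List ℕ) (f : MvPolynomial (Fin n) ℤ) : MvPolynomial (Fin n) ℤ :=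
  L.foldr (dem n) f

/-- Entry accessor for a composition, 0-indexed position, default `0` out of range. -/
def ent (n : ℕ) (α : Fin n → ℕ) (p : ℕ) : ℕ := if h : p < n then α ⟨p, h⟩ else 0

/-- Exchange the entries of `α` in (0-indexed) positions `p` and `p+1`. -/
def swapAt (n : ℕ) (p : ℕ) (α : Fin n → ℕ) : Fin n → ℕ := fun m =>
  if (m : ℕ) = p then ent n α (p + 1) else if (m : ℕ) = p + 1 then ent n α p else α m

/-- Auxiliary fuelled recursion computing the key polynomial `κ_α`:
if `α` is weakly decreasing, `κ_α = x^α`; otherwise, choosing an ascent `α_p < α_{p+1}`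
(0-indexed `p`), `κ_α = π_{p+1}(κ_{α̂})` where `α̂` swaps the two entries.  The fuel
`n*n` in `keyPoly` strictly exceeds the number of co-inversions, which drops by one at
each step, so the recursion always terminates at a weakly decreasing composition. -/
def keyAux (n : ℕ) : ℕ → (Fin n → ℕ) → MvPolynomial (Fin n) ℤ
  | 0, α => mono n α
  | k + 1, α =>
    if h : ∃ p : Fin n, ent n α p.1 < ent n α (p.1 + 1) then
      dem n (h.choose.1 + 1) (keyAux n k (swapAt n h.choose.1 α))
    else mono n α

/-- The key polynomial `κ_α`. -/
def keyPoly (n : ℕ) (α : Fin n → ℕ) : MvPolynomial (Fin n) ℤ := keyAux n (n * n) α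

/-- `wλ`, the composition `(λ_{w⁻¹(1)}, …, λ_{w⁻¹(n)})`. -/
def pact (n : ℕ) (w : Equiv.Perm (Fin n)) (lam : Fin n → ℕ) : Fin n → ℕ :=
  fun i => lam (w⁻¹ i)

/-- `lam` is a partition (weakly decreasing vector) with at most `n` parts. -/
def IsPartition (n : ℕ) (lam : Fin n → ℕ) : Prop := ∀ i j : Fin n, i ≤ j → lam j ≤ lam i

/-- Box `(c, r)` (column, row; both 1-indexed) belongs to the skyline diagram `D(α)`. -/
def InDiag (n : ℕ) (α : Fin n → ℕ) (c r : ℕ) : Prop :=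
  1 ≤ c ∧ c ≤ n ∧ 1 ≤ r ∧ r ≤ ent n α (c - 1)

/-- `F` (value of box (column, row)) is a filling of `D(α)` that is flagged (labels in
column `c` are in `{1, …, c}`) and row distinct. -/
def IsTab (n : ℕ) (α : Fin n → ℕ) (F : ℕ → ℕ → ℕ) : Prop :=
  (∀ c r, InDiag n α c r → 1 ≤ F c r ∧ F c r ≤ c) ∧
  ∀ c c' r, InDiag n α c r → InDiag n α c' r → c ≠ c' → F c r ≠ F c' r

/-- The weight of a filling: `wt(F)_i` = number of occurrences of the label `i`
(1-indexed; `Fin` position `i` records the label `i+1`). -/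
def wt (n : ℕ) (α : Fin n → ℕ) (F : ℕ → ℕ → ℕ) : Fin n → ℕ := fun i =>
  ((Finset.Icc 1 n ×ˢ Finset.Icc 1 (Finset.univ.sup α)).filter fun p =>
    InDiag n α p.1 p.2 ∧ F p.1 p.2 = i.1 + 1).card

/-- `leftmin_α(i) = min{α_j : j ≤ i}`. -/
def leftmin (n : ℕ) (α : Fin n → ℕ) (i : Fin n) : ℕ := sInf (α '' {j | j ≤ i})

/-- `rightmax_α(i) = max{α_j : j ≥ i}`. -/
def rightmax (n : ℕ) (α : Fin n → ℕ) (i : Fin n) : ℕ :=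
  Finset.sup (Finset.univ.filter fun j => i ≤ j) α

/-- `d` records `0 = d_0 < d_1 < ⋯ < d_k < d_{k+1} = n`. -/
def BlockData (n k : ℕ) (d : Fin (k + 2) → ℕ) : Prop :=
  d 0 = 0 ∧ d (Fin.last (k + 1)) = n ∧ StrictMono d

/-- `D = {d_1, …, d_k}` as a set of natural numbers. -/
def Dset (k : ℕ) (d : Fin (k + 2) → ℕ) : Set ℕ :=
  {m | ∃ t : Fin (k + 2), t ≠ 0 ∧ t ≠ Fin.last (k + 1) ∧ d t = m}

/-- `I = [n−1] ∖ D`. -/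
def Iset (n k : ℕ) (d : Fin (k + 2) → ℕ) : Set ℕ :=
  {m | 1 ≤ m ∧ m ≤ n - 1 ∧ m ∉ Dset k d}

/-- Positions `i, j` (of `Fin n`, 0-indexed; 1-indexed letters `i+1, j+1`) lie in the same
block: some `t` has `d_t < i+1, j+1 ≤ d_{t+1}`. -/
def SameBlock (n k : ℕ) (d : Fin (k + 2) → ℕ) (i j : Fin n) : Prop :=
  ∃ t : Fin (k + 1), d t.castSucc ≤ i.1 ∧ i.1 < d t.succ ∧ d t.castSucc ≤ j.1 ∧ j.1 < d t.succ

/-- The variables `X_t = {x_{d_t + 1}, …, x_{d_{t+1}}}` of the `t`-th block. -/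
def blockVars (n k : ℕ) (d : Fin (k + 2) → ℕ) (t : Fin (k + 1)) : Finset (Fin n) :=
  Finset.univ.filter fun p => d t.castSucc ≤ p.1 ∧ p.1 < d t.succ

/-- Complete homogeneous symmetric polynomial of degree `m` in the variables `S`. -/
def hPoly (n : ℕ) (S : Finset (Fin n)) (m : ℕ) : MvPolynomial (Fin n) ℤ :=
  ∑ f ∈ S.sym m, ((f : Multiset (Fin n)).map X).prod

/-- `h_z` for `z : ℤ`, with `h_z = 0` for `z < 0`. -/
def hZ (n : ℕ) (S : Finset (Fin n)) (z : ℤ) : MvPolynomial (Fin n) ℤ :=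
  if 0 ≤ z then hPoly n S z.toNat else 0

/-- The Schur polynomial `s_lam` in the variable set `S`, for a partition `lam`
(1-indexed parts, at most `t` of them), via the Jacobi–Trudi determinant
`det(h_{lam_i − i + j})_{1 ≤ i,j ≤ t}`. -/
def schurP (n : ℕ) (S : Finset (Fin n)) (t : ℕ) (lam : ℕ → ℕ) : MvPolynomial (Fin n) ℤ :=
  (Matrix.of fun i j : Fin t =>
    hZ n S ((lam (i.1 + 1) : ℤ) - (i.1 + 1) + (j.1 + 1))).det

/-- `γ ∈ Par_D`: a `(k+1)`-tuple of partitions, the `t`-th having at most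
`d_{t+1} − d_t` nonzero parts (1-indexed parts; the unused index `0` is normalized to `0`). -/
def ParD (k : ℕ) (d : Fin (k + 2) → ℕ) (γ : Fin (k + 1) → ℕ → ℕ) : Prop :=
  ∀ t : Fin (k + 1), γ t 0 = 0 ∧ (∀ a b : ℕ, 1 ≤ a → a ≤ b → γ t b ≤ γ t a) ∧
    ∀ m : ℕ, d t.succ - d t.castSucc < m → γ t m = 0

/-- The `D`-Schur polynomial `s_{γ^1,…,γ^{k+1}} = ∏_t s_{γ^t}(X_t)`. -/
def dSchur (n k : ℕ) (d : Fin (k + 2) → ℕ) (γ : Fin (k + 1) → ℕ → ℕ) :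
    MvPolynomial (Fin n) ℤ :=
  ∏ t : Fin (k + 1), schurP n (blockVars n k d t) (d t.succ - d t.castSucc) (γ t)

/-- Truncation of an integer vector to a natural-number vector. -/
def toNatV (n : ℕ) (β : Fin n → ℤ) : Fin n → ℕ := fun i => (β i).toNat

/-- `j − i` as an integer. -/
def gapZ (n : ℕ) (i j : Fin n) : ℤ := (j.1 : ℤ) - (i.1 : ℤ)

/-- The move `t_{ij}`: replace `β_i` by `β_j − (j−i)` and `β_j` by `β_i + (j−i)`. -/
def tmv (n : ℕ) (i j : Fin n) (β : Fin n → ℤ) : Fin n → ℤ := fun m =>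
  if m = i then β j - gapZ n i j else if m = j then β i + gapZ n i j else β m

/-- The rank `θ(β) = #{(a,b) : a < b in the same block and β_a < β_b − (b−a)}`. -/
def theta (n k : ℕ) (d : Fin (k + 2) → ℕ) (β : Fin n → ℤ) : ℕ :=
  (Finset.univ.filter fun p : Fin n × Fin n =>
    p.1 < p.2 ∧ SameBlock n k d p.1 p.2 ∧ β p.1 < β p.2 - gapZ n p.1 p.2).card

/-- One step up in the Bruhat-type order: `β ⋖ t_{ij} β` whenever `i < j` are in the same
block and `β_i > β_j − (j−i)`. -/
def stepUp (n k : ℕ) (d : Fin (k + 2) → ℕ) (β β' : Fin n → ℤ) : Prop :=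
  ∃ i j : Fin n, i < j ∧ SameBlock n k d i j ∧ β j - gapZ n i j < β i ∧ β' = tmv n i j β

/-- The order on compositions: transitive (reflexive) closure of `stepUp`. -/
def leB (n k : ℕ) (d : Fin (k + 2) → ℕ) : (Fin n → ℤ) → (Fin n → ℤ) → Prop :=
  Relation.ReflTransGen (stepUp n k d)

/-- Membership in the poset `P_{α,γ}` (for `α = cλ`): `β` is a weak composition with
`[x^β] κ_α ≠ 0` and `π_{w_0(I)}(x^β) = ± s_γ`. -/
def memP (n k : ℕ) (d : Fin (k + 2) → ℕ) (w0I : Equiv.Perm (Fin n)) (α : Fin n → ℕ)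
    (γ : Fin (k + 1) → ℕ → ℕ) (β : Fin n → ℤ) : Prop :=
  (∀ i, 0 ≤ β i) ∧ coeffOf n (toNatV n β) (keyPoly n α) ≠ 0 ∧
  ∃ L, IsRedWord n L w0I ∧
    (demWord n L (mono n (toNatV n β)) = dSchur n k d γ ∨
     demWord n L (mono n (toNatV n β)) = -dSchur n k d γ)

/-- The pair `i < j` is interweaved for `α`: `α_m ≥ α_{m+1}` for `i ≤ m < j`,
`leftmin_α(i) < α_i` and `rightmax_α(j) > α_j`. -/
def Interweaved (n : ℕ) (α : Fin n → ℕ) (i j : Fin n) : Prop :=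
  i < j ∧ (∀ p : Fin n, i ≤ p → p < j → ent n α (p.1 + 1) ≤ α p) ∧
  leftmin n α i < α i ∧ α j < rightmax n α j

/-- `center_α(i,j) = max{m : i ≤ m ≤ j and α_m ≥ rightmax_α(j)}` (as a 0-indexed position). -/
def center (n : ℕ) (α : Fin n → ℕ) (i j : Fin n) : ℕ :=
  Finset.sup (Finset.univ.filter fun p : Fin n => i ≤ p ∧ p ≤ j ∧ rightmax n α j ≤ α p)
    fun p => p.1

/-- Partial sum `β_1 + ⋯ + β_{m+1}` (0-indexed positions `≤ m`) of an integer vector. -/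
def psumZ (n : ℕ) (β : Fin n → ℤ) (m : ℕ) : ℤ :=
  ∑ p ∈ Finset.univ.filter (fun p : Fin n => p.1 ≤ m), β p

/-- Partial sum of a composition, as an integer. -/
def psumN (n : ℕ) (α : Fin n → ℕ) (m : ℕ) : ℤ :=
  ∑ p ∈ Finset.univ.filter (fun p : Fin n => p.1 ≤ m), (α p : ℤ)

/-- Composition pattern containment. -/
def ContainsPat (n : ℕ) {m : ℕ} (α : Fin n → ℕ) (pat : Fin m → ℕ) : Prop :=
  ∃ g : Fin m → Fin n, StrictMono g ∧
    (∀ s t : Fin m, pat s ≤ pat t ↔ α (g s) ≤ α (g t)) ∧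
    ∀ s t : Fin m, |(pat s : ℤ) - (pat t : ℤ)| ≤ |(α (g s) : ℤ) - (α (g t) : ℤ)|

end

end LSS

open scoped Classical

namespace LSS

section PartA
open MvPolynomial

theorem sub_dvd_swap {n : ℕ} (a b : Fin n) (f : MvPolynomial (Fin n) ℤ) :
    (X a - X b) ∣ f - rename (⇑(Equiv.swap a b)) f := by
  induction f using MvPolynomial.induction_on with
  | C r => simp
  | add p q hp hq =>
    have := dvd_add hp hq
    convert this using 1
    simp only [map_add]; ring
  | mul_X p k hp =>
    have h1 : (X a - X b : MvPolynomial (Fin n) ℤ) ∣ X k - X (Equiv.swap a b k) := by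
      by_cases hka : k = a
      · subst hka; simp
      · by_cases hkb : k = b
        · subst hkb
          rw [Equiv.swap_apply_right]
          exact ⟨-1, by ring⟩
        · rw [Equiv.swap_apply_of_ne_of_ne hka hkb]; simp
    have h2 := dvd_add (hp.mul_right (X k)) (h1.mul_left (rename (⇑(Equiv.swap a b)) p))
    convert h2 using 1
    simp only [map_mul, rename_X]; ring

theorem X_sub_ne {n : ℕ} {a b : Fin n} (h : a ≠ b) :
    (X a - X b : MvPolynomial (Fin n) ℤ) ≠ 0 := by
  intro h0
  have := sub_eq_zero.mp h0
  exact h (MvPolynomial.X_injective this)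

theorem dem_spec {n m : ℕ} (h : 0 < m ∧ m < n) (f : MvPolynomial (Fin n) ℤ) :
    (X (⟨m - 1, by omega⟩ : Fin n) - X (⟨m, h.2⟩ : Fin n)) * dem n m f =
      X (⟨m - 1, by omega⟩ : Fin n) * f - X (⟨m, h.2⟩ : Fin n) *
        rename (⇑(Equiv.swap (⟨m - 1, by omega⟩ : Fin n) (⟨m, h.2⟩ : Fin n))) f := by
  have hg : ∃ g, (X (⟨m - 1, by omega⟩ : Fin n) - X (⟨m, h.2⟩ : Fin n)) * g =
        X (⟨m - 1, by omega⟩ : Fin n) * f -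
          X (⟨m, h.2⟩ : Fin n) *
            rename (⇑(Equiv.swap (⟨m - 1, by omega⟩ : Fin n) (⟨m, h.2⟩ : Fin n))) f := by
    obtain ⟨g, hg⟩ := sub_dvd_swap (⟨m - 1, by omega⟩ : Fin n) (⟨m, h.2⟩ : Fin n) f
    refine ⟨X (⟨m, h.2⟩ : Fin n) * g + f, ?_⟩
    linear_combination (-X (⟨m, h.2⟩ : Fin n) : MvPolynomial (Fin n) ℤ) * hg
  unfold dem
  rw [dif_pos h, dif_pos hg]
  exact hg.choose_spec

theorem dem_unique {n m : ℕ} (h : 0 < m ∧ m < n) (f g : MvPolynomial (Fin n) ℤ)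
    (hg : (X (⟨m - 1, by omega⟩ : Fin n) - X (⟨m, h.2⟩ : Fin n)) * g =
      X (⟨m - 1, by omega⟩ : Fin n) * f - X (⟨m, h.2⟩ : Fin n) *
        rename (⇑(Equiv.swap (⟨m - 1, by omega⟩ : Fin n) (⟨m, h.2⟩ : Fin n))) f) :
    dem n m f = g := by
  have hne : (⟨m - 1, by omega⟩ : Fin n) ≠ ⟨m, h.2⟩ := by
    intro h'; simp at h'; omega
  exact mul_left_cancel₀ (X_sub_ne hne) ((dem_spec h f).trans hg.symm)

theorem dem_add (n m : ℕ) (f g : MvPolynomial (Fin n) ℤ) :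
    dem n m (f + g) = dem n m f + dem n m g := by
  by_cases h : 0 < m ∧ m < n
  · apply dem_unique h
    rw [mul_add, dem_spec h, dem_spec h, map_add]; ring
  · simp [dem, h]

theorem dem_smul (n m : ℕ) (r : ℤ) (f : MvPolynomial (Fin n) ℤ) :
    dem n m (C r * f) = C r * dem n m f := by
  by_cases h : 0 < m ∧ m < n
  · apply dem_unique h
    have := dem_spec h f
    rw [map_mul, rename_C]
    linear_combination (C r) * this
  · simp [dem, h]

theorem dem_sym_mul (n m : ℕ) (e f : MvPolynomial (Fin n) ℤ)
    (he : ∀ a b : Fin n, rename (⇑(Equiv.swap a b)) e = e) :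
    dem n m (e * f) = e * dem n m f := by
  by_cases h : 0 < m ∧ m < n
  · apply dem_unique h
    have := dem_spec h f
    rw [map_mul, he]
    linear_combination e * this
  · simp [dem, h]

theorem dem_zero (n m : ℕ) : dem n m 0 = 0 := by
  have := dem_smul n m 0 0
  simpa using this

theorem demWord_zero (n : ℕ) (L : List ℕ) : demWord n L 0 = 0 := by
  induction L with
  | nil => rfl
  | cons a L ih => show dem n a (demWord n L 0) = 0; rw [ih, dem_zero]

theorem demWord_add (n : ℕ) (L : List ℕ) (f g : MvPolynomial (Fin n) ℤ) :
    demWord n L (f + g) = demWord n L f + demWord n L g := by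
  induction L with
  | nil => rfl
  | cons a L ih =>
    show dem n a (demWord n L (f + g)) = dem n a (demWord n L f) + dem n a (demWord n L g)
    rw [ih, dem_add]

theorem demWord_sym_mul (n : ℕ) (L : List ℕ) (e f : MvPolynomial (Fin n) ℤ)
    (he : ∀ a b : Fin n, rename (⇑(Equiv.swap a b)) e = e) :
    demWord n L (e * f) = e * demWord n L f := by
  induction L with
  | nil => rfl
  | cons a L ih =>
    show dem n a (demWord n L (e * f)) = e * dem n a (demWord n L f)
    rw [ih, dem_sym_mul n a e _ he]

theorem demWord_append (n : ℕ) (L M : List ℕ) (f : MvPolynomial (Fin n) ℤ) :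
    demWord n (L ++ M) f = demWord n L (demWord n M f) := by
  simp [demWord, List.foldr_append]

theorem dem_sum (n m : ℕ) {ι : Type*} (s : Finset ι) (F : ι → MvPolynomial (Fin n) ℤ) :
    dem n m (∑ x ∈ s, F x) = ∑ x ∈ s, dem n m (F x) := by
  induction s using Finset.induction_on with
  | empty => simp [dem_zero]
  | insert a s ha ih => rw [Finset.sum_insert ha, Finset.sum_insert ha, dem_add, ih]

/-- the Demazure operator on a dominant monomial -/
theorem dem_monomial {n m : ℕ} (h : 0 < m ∧ m < n) (s : Fin n →₀ ℕ)
    (hs : s ⟨m, h.2⟩ ≤ s ⟨m - 1, by omega⟩) :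
    dem n m (monomial s 1) =
      ∑ t ∈ Finset.range (s ⟨m - 1, by omega⟩ - s ⟨m, h.2⟩ + 1),
        monomial (s - Finsupp.single (⟨m - 1, by omega⟩ : Fin n) t +
          Finsupp.single (⟨m, h.2⟩ : Fin n) t) (1 : ℤ) := by
  set a : Fin n := ⟨m - 1, by omega⟩ with ha
  set b : Fin n := ⟨m, h.2⟩ with hb
  have hab : a ≠ b := by
    intro h'; simp [ha, hb] at h'; omega
  set k := s a - s b with hk
  set r : Fin n →₀ ℕ := s - Finsupp.single a k with hr
  have hrs : s = r + Finsupp.single a k := by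
    ext x
    by_cases hx : x = a
    · subst hx; simp [hr]; omega
    · simp [hr, Finsupp.single_apply, Ne.symm hx]
  have hra : r a = r b := by
    simp [hr, Finsupp.single_apply, hab]; omega
  have hrsw : Finsupp.mapDomain (⇑(Equiv.swap a b)) r = r := by
    ext x
    have := Finsupp.mapDomain_apply (Equiv.swap a b).injective r (Equiv.swap a b x)
    rw [Equiv.swap_apply_self] at this
    rw [this]
    by_cases hx : x = a
    · subst hx; rw [Equiv.swap_apply_left, hra]
    · by_cases hx' : x = b
      · subst hx'; rw [Equiv.swap_apply_right, hra]
      · rw [Equiv.swap_apply_of_ne_of_ne hx hx']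
  have hmon : (monomial s 1 : MvPolynomial (Fin n) ℤ) = monomial r 1 * X a ^ k := by
    rw [hrs, X_pow_eq_monomial, monomial_mul, one_mul]
  have hterm : ∀ t ∈ Finset.range (k + 1),
      (monomial (s - Finsupp.single a t + Finsupp.single b t) (1 : ℤ)) =
        monomial r 1 * (X b ^ t * X a ^ (k + 1 - 1 - t)) := by
    intro t ht
    have ht' : t ≤ k := by simp at ht; omega
    rw [X_pow_eq_monomial, X_pow_eq_monomial, monomial_mul, monomial_mul]
    simp only [one_mul]
    refine congrArg (fun u => monomial u (1 : ℤ)) ?_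
    rw [hrs]
    ext x
    by_cases hx : x = a
    · subst hx; simp [Finsupp.single_apply, hab.symm]; omega
    · by_cases hx' : x = b
      · subst hx'; simp [Finsupp.single_apply, hab]
      · simp [Finsupp.single_apply, Ne.symm hx, Ne.symm hx']
  apply dem_unique h
  rw [Finset.sum_congr rfl hterm, ← Finset.mul_sum, hmon, map_mul, rename_monomial, map_pow,
    rename_X, ← ha, ← hb, hrsw, Equiv.swap_apply_left]
  have hgeo := (Commute.all (X b : MvPolynomial (Fin n) ℤ) (X a)).geom_sum₂_mul (k + 1)
  linear_combination (-(monomial r 1 : MvPolynomial (Fin n) ℤ)) * hgeo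

end PartA

end LSS

open scoped Classical

namespace LSS

section PartA2
open MvPolynomial

theorem dem_eq_zero {n m : ℕ} (h : 0 < m ∧ m < n) (f : MvPolynomial (Fin n) ℤ)
    (hf : X (⟨m - 1, by omega⟩ : Fin n) * f = X (⟨m, h.2⟩ : Fin n) *
        rename (⇑(Equiv.swap (⟨m - 1, by omega⟩ : Fin n) (⟨m, h.2⟩ : Fin n))) f) :
    dem n m f = 0 := by
  apply dem_unique h
  rw [hf]; ring

theorem dem_comm {n m k : ℕ} (hm : 0 < m ∧ m < n) (hk : 0 < k ∧ k < n) (hmk : m + 1 < k)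
    (f : MvPolynomial (Fin n) ℤ) :
    dem n m (dem n k f) = dem n k (dem n m f) := by
  have e1 := dem_spec hm (dem n k f)
  have e2 := dem_spec hk f
  have e3 := dem_spec hk (dem n m f)
  have e4 := dem_spec hm f
  set a : Fin n := ⟨m - 1, by omega⟩ with ha
  set b : Fin n := ⟨m, hm.2⟩ with hb
  set c : Fin n := ⟨k - 1, by omega⟩ with hc
  set d : Fin n := ⟨k, hk.2⟩ with hd
  have hab : a ≠ b := by intro h; simp [ha, hb] at h; omega
  have hac : a ≠ c := by intro h; simp [ha, hc] at h; omega
  have had : a ≠ d := by intro h; simp [ha, hd] at h; omega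
  have hbc : b ≠ c := by intro h; simp [hb, hc] at h; omega
  have hbd : b ≠ d := by intro h; simp [hb, hd] at h; omega
  have hcd : c ≠ d := by intro h; simp [hc, hd] at h; omega
  have e2' := congrArg (rename (⇑(Equiv.swap a b))) e2
  have e4' := congrArg (rename (⇑(Equiv.swap c d))) e4
  simp only [map_mul, map_sub, rename_X, Equiv.swap_apply_of_ne_of_ne hac.symm hbc.symm,
    Equiv.swap_apply_of_ne_of_ne had.symm hbd.symm, Equiv.swap_apply_of_ne_of_ne hac had,
    Equiv.swap_apply_of_ne_of_ne hbc hbd] at e2' e4'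
  have hss : rename (⇑(Equiv.swap a b)) (rename (⇑(Equiv.swap c d)) f) =
      rename (⇑(Equiv.swap c d)) (rename (⇑(Equiv.swap a b)) f) := by
    rw [rename_rename, rename_rename]
    have : (⇑(Equiv.swap a b) ∘ ⇑(Equiv.swap c d)) = (⇑(Equiv.swap c d) ∘ ⇑(Equiv.swap a b)) := by
      funext x
      have hd : Equiv.Perm.Disjoint (Equiv.swap a b) (Equiv.swap c d) := by
        intro y
        by_cases hya : y = a
        · right; rw [hya]; exact Equiv.swap_apply_of_ne_of_ne hac had
        · by_cases hyb : y = b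
          · right; rw [hyb]; exact Equiv.swap_apply_of_ne_of_ne hbc hbd
          · left; exact Equiv.swap_apply_of_ne_of_ne hya hyb
      have := hd.commute.eq
      exact congrArg (fun σ : Equiv.Perm (Fin n) => σ x) this
    rw [this]
  rw [hss] at e2'
  apply mul_left_cancel₀ (mul_ne_zero (X_sub_ne hab) (X_sub_ne hcd))
  linear_combination (X c - X d) * e1 + X a * e2 - X b * e2' - (X a - X b) * e3 - X c * e4 +
    X d * e4'

theorem dem_braid {n m : ℕ} (hm : 0 < m ∧ m < n) (hk : 0 < m + 1 ∧ m + 1 < n)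
    (f : MvPolynomial (Fin n) ℤ) :
    dem n m (dem n (m + 1) (dem n m f)) = dem n (m + 1) (dem n m (dem n (m + 1) f)) := by
  have g1 := dem_spec hm f
  have g2 := dem_spec hk (dem n m f)
  have g3 := dem_spec hm (dem n (m + 1) (dem n m f))
  have u1 := dem_spec hk f
  have u2 := dem_spec hm (dem n (m + 1) f)
  have u3 := dem_spec hk (dem n m (dem n (m + 1) f))
  have hcc : (⟨m + 1 - 1, by omega⟩ : Fin n) = ⟨m, hm.2⟩ := by simp
  rw [hcc] at g2 u1 u3
  set a : Fin n := ⟨m - 1, by omega⟩ with ha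
  set b : Fin n := ⟨m, hm.2⟩ with hb
  set c : Fin n := ⟨m + 1, hk.2⟩ with hc
  have hab : a ≠ b := by intro h; simp [ha, hb] at h; omega
  have hac : a ≠ c := by intro h; simp [ha, hc] at h
  have hbc : b ≠ c := by intro h; simp [hb, hc] at h
  have sc : Equiv.swap a b c = c := Equiv.swap_apply_of_ne_of_ne hac.symm hbc.symm
  have ra : Equiv.swap b c a = a := Equiv.swap_apply_of_ne_of_ne hab hac
  set g := dem n m f
  set h := dem n (m + 1) g
  set k := dem n m h
  set u := dem n (m + 1) f
  set v := dem n m u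
  set w := dem n (m + 1) v
  have ss : ∀ p : MvPolynomial (Fin n) ℤ,
      rename (⇑(Equiv.swap a b)) (rename (⇑(Equiv.swap a b)) p) = p := by
    intro p; rw [rename_rename, ← Equiv.Perm.coe_mul, Equiv.swap_mul_self]; simp
  have rr : ∀ p : MvPolynomial (Fin n) ℤ,
      rename (⇑(Equiv.swap b c)) (rename (⇑(Equiv.swap b c)) p) = p := by
    intro p; rw [rename_rename, ← Equiv.Perm.coe_mul, Equiv.swap_mul_self]; simp
  have g1r := congrArg (rename (⇑(Equiv.swap b c))) g1
  have g1s := congrArg (rename (⇑(Equiv.swap a b))) g1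
  have g1rs := congrArg (rename (⇑(Equiv.swap a b))) g1r
  have g2s := congrArg (rename (⇑(Equiv.swap a b))) g2
  have u1s := congrArg (rename (⇑(Equiv.swap a b))) u1
  have u1r := congrArg (rename (⇑(Equiv.swap b c))) u1
  have u1sr := congrArg (rename (⇑(Equiv.swap b c))) u1s
  have u2r := congrArg (rename (⇑(Equiv.swap b c))) u2
  simp only [map_mul, map_sub, rename_X, sc, ra, Equiv.swap_apply_left, Equiv.swap_apply_right,
    ss, rr] at g1r g1s g1rs g2s u1s u1r u1sr u2r
  have hbr : rename (⇑(Equiv.swap a b)) (rename (⇑(Equiv.swap b c))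
      (rename (⇑(Equiv.swap a b)) f)) = rename (⇑(Equiv.swap b c)) (rename (⇑(Equiv.swap a b))
      (rename (⇑(Equiv.swap b c)) f)) := by
    simp only [rename_rename]
    congr 2
    funext x
    simp only [Function.comp]
    by_cases h1 : x = a
    · subst h1; simp [sc, ra]
    · by_cases h2 : x = b
      · subst h2; simp [sc, ra]
      · by_cases h3 : x = c
        · subst h3; simp [sc, ra]
        · simp [Equiv.swap_apply_of_ne_of_ne, h1, h2, h3]
  have sg : rename (⇑(Equiv.swap a b)) g = g := by
    apply mul_left_cancel₀ (X_sub_ne hab)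
    linear_combination -g1s - g1
  have ru : rename (⇑(Equiv.swap b c)) u = u := by
    apply mul_left_cancel₀ (X_sub_ne hbc)
    linear_combination -u1r - u1
  rw [sg] at g2s
  rw [ru] at u2r
  rw [hbr] at g1rs
  apply mul_left_cancel₀ (mul_ne_zero (mul_ne_zero (X_sub_ne hab) (X_sub_ne hac)) (X_sub_ne hbc))
  linear_combination (X a - X c) * (X b - X c) * g3 + X a * (X a - X c) * g2 -
    X b * (X b - X c) * g2s + X a * X b * g1 - X a * X c * g1r + X b * X c * g1rs
    - (X a - X b) * (X a - X c) * u3 - X b * (X a - X c) * u2 + X c * (X a - X b) * u2r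
    - X a ^ 2 * u1 + X b ^ 2 * u1s - X c ^ 2 * u1sr

theorem dem_coeff {n m : ℕ} (h : 0 < m ∧ m < n) (f : MvPolynomial (Fin n) ℤ)
    (hpos : ∀ s, 0 ≤ coeff s f)
    (hdom : ∀ s, coeff s f ≠ 0 → s ⟨m, h.2⟩ ≤ s ⟨m - 1, by omega⟩) :
    (∀ e, 0 ≤ coeff e (dem n m f)) ∧
    ∀ e, coeff e (dem n m f) ≠ 0 ↔ ∃ s, coeff s f ≠ 0 ∧
      ∃ t, t ≤ s ⟨m - 1, by omega⟩ - s ⟨m, h.2⟩ ∧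
        e = s - Finsupp.single (⟨m - 1, by omega⟩ : Fin n) t +
          Finsupp.single (⟨m, h.2⟩ : Fin n) t := by
  have hf : dem n m f = ∑ s ∈ f.support, C (coeff s f) *
      ∑ t ∈ Finset.range (s ⟨m - 1, by omega⟩ - s ⟨m, h.2⟩ + 1),
        monomial (s - Finsupp.single (⟨m - 1, by omega⟩ : Fin n) t +
          Finsupp.single (⟨m, h.2⟩ : Fin n) t) (1 : ℤ) := by
    conv_lhs => rw [f.as_sum]
    rw [dem_sum]
    refine Finset.sum_congr rfl fun s hs => ?_
    have : (monomial s (coeff s f) : MvPolynomial (Fin n) ℤ) = C (coeff s f) * monomial s 1 := by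
      rw [C_mul_monomial, mul_one]
    rw [this, dem_smul, dem_monomial h s (hdom s (by simpa using hs))]
  have hc : ∀ e, coeff e (dem n m f) = ∑ s ∈ f.support, coeff s f *
      ∑ t ∈ Finset.range (s ⟨m - 1, by omega⟩ - s ⟨m, h.2⟩ + 1),
        if (s - Finsupp.single (⟨m - 1, by omega⟩ : Fin n) t +
          Finsupp.single (⟨m, h.2⟩ : Fin n) t) = e then (1 : ℤ) else 0 := by
    intro e
    rw [hf, coeff_sum]
    refine Finset.sum_congr rfl fun s hs => ?_
    rw [coeff_C_mul, coeff_sum]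
    simp only [coeff_monomial]
  have hin : ∀ e s, 0 ≤ ∑ t ∈ Finset.range (s ⟨m - 1, by omega⟩ - s ⟨m, h.2⟩ + 1),
        if (s - Finsupp.single (⟨m - 1, by omega⟩ : Fin n) t +
          Finsupp.single (⟨m, h.2⟩ : Fin n) t) = e then (1 : ℤ) else 0 := by
    intro e s
    exact Finset.sum_nonneg fun t _ => by split_ifs <;> norm_num
  refine ⟨fun e => ?_, fun e => ?_⟩
  · rw [hc]
    exact Finset.sum_nonneg fun s _ => mul_nonneg (hpos s) (hin e s)
  · rw [hc, Ne, Finset.sum_eq_zero_iff_of_nonneg (fun s _ => mul_nonneg (hpos s) (hin e s))]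
    constructor
    · intro hne
      push Not at hne
      obtain ⟨s, hs, hs'⟩ := hne
      have h2 := right_ne_zero_of_mul hs'
      obtain ⟨t, ht, ht'⟩ := Finset.exists_ne_zero_of_sum_ne_zero h2
      refine ⟨s, left_ne_zero_of_mul hs', t, by simp at ht; omega, ?_⟩
      by_contra hcon
      rw [if_neg (fun h => hcon h.symm)] at ht'
      exact ht' rfl
    · rintro ⟨s, hs, t, ht, rfl⟩ hall
      have := hall s (by simpa using hs)
      rcases mul_eq_zero.mp this with h1 | h1
      · exact hs h1
      · rw [Finset.sum_eq_zero_iff_of_nonneg (fun t _ => by split_ifs <;> norm_num)] at h1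
        have := h1 t (by simp; omega)
        simp at this

end PartA2

end LSS

open scoped Classical

namespace LSS

section PartM

theorem st_eq {n m : ℕ} (h : 0 < m ∧ m < n) :
    st n m = Equiv.swap ⟨m - 1, by omega⟩ ⟨m, h.2⟩ := by
  unfold st; rw [dif_pos h]

theorem st_mul_self (n m : ℕ) : st n m * st n m = 1 := by
  unfold st; split_ifs <;> simp

theorem st_mul_cancel (n m : ℕ) (w : Equiv.Perm (Fin n)) : st n m * (st n m * w) = w := by
  rw [← mul_assoc, st_mul_self, one_mul]

theorem st_inv (n m : ℕ) : (st n m)⁻¹ = st n m := by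
  rw [inv_eq_iff_mul_eq_one]; exact st_mul_self n m

/-- the value of the simple transposition -/
theorem st_val {n m : ℕ} (h : 0 < m ∧ m < n) (x : Fin n) :
    ((st n m x : Fin n) : ℕ) = if x.1 = m - 1 then m else if x.1 = m then m - 1 else x.1 := by
  rw [st_eq h, Equiv.swap_apply_def]
  simp only [Fin.ext_iff]
  split_ifs <;> rfl

theorem st_rev {n m : ℕ} (h : 0 < m ∧ m < n) {x y : Fin n} (hxy : x < y)
    (hs : st n m y < st n m x) : x.1 = m - 1 ∧ y.1 = m := by
  rw [Fin.lt_def] at hxy hs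
  rw [st_val h, st_val h] at hs
  split_ifs at hs <;> omega

theorem len_mul_le (n : ℕ) (u v : Equiv.Perm (Fin n)) : len n (u * v) ≤ len n u + len n v := by
  unfold len
  have hsub : (Finset.univ.filter fun p : Fin n × Fin n => p.1 < p.2 ∧ (u * v) p.2 < (u * v) p.1) ⊆
      ((Finset.univ.filter fun p : Fin n × Fin n => p.1 < p.2 ∧ u p.2 < u p.1).image
        (fun p => (v⁻¹ p.1, v⁻¹ p.2))) ∪
      (Finset.univ.filter fun p : Fin n × Fin n => p.1 < p.2 ∧ v p.2 < v p.1) := by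
    rintro ⟨a, b⟩ hab
    replace hab := (Finset.mem_filter.mp hab).2
    rw [Finset.mem_union]
    by_cases h : v b < v a
    · right; simp [hab.1, h]
    · left
      rw [Finset.mem_image]
      refine ⟨(v a, v b), ?_, by simp⟩
      have hne : v a ≠ v b := fun h' => hab.1.ne (v.injective h')
      simp only [Finset.mem_filter, Finset.mem_univ, true_and]
      exact ⟨lt_of_le_of_ne (not_lt.mp h) hne, hab.2⟩
  refine (Finset.card_le_card hsub).trans ((Finset.card_union_le _ _).trans ?_)
  exact Nat.add_le_add_right Finset.card_image_le _

theorem len_one (n : ℕ) : len n 1 = 0 := by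
  unfold len
  rw [Finset.card_eq_zero, Finset.filter_eq_empty_iff]
  rintro ⟨a, b⟩ _ ⟨h1, h2⟩
  exact absurd h1 (not_lt.mpr (le_of_lt h2))

theorem len_inv_le (n : ℕ) (w : Equiv.Perm (Fin n)) : len n w⁻¹ ≤ len n w := by
  unfold len
  apply Finset.card_le_card_of_injOn (fun p => (w⁻¹ p.2, w⁻¹ p.1))
  · rintro ⟨a, b⟩ h
    simp at h ⊢
    exact ⟨h.2, h.1⟩
  · rintro ⟨a, b⟩ _ ⟨a', b'⟩ _ h
    simp at h
    ext <;> simp [h.1, h.2]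

theorem len_inv (n : ℕ) (w : Equiv.Perm (Fin n)) : len n w⁻¹ = len n w :=
  le_antisymm (len_inv_le n w) (by simpa using len_inv_le n w⁻¹)

theorem len_st_le (n m : ℕ) : len n (st n m) ≤ 1 := by
  by_cases h : 0 < m ∧ m < n
  · unfold len
    have : (Finset.univ.filter fun p : Fin n × Fin n => p.1 < p.2 ∧ st n m p.2 < st n m p.1) ⊆
        {((⟨m - 1, by omega⟩ : Fin n), (⟨m, h.2⟩ : Fin n))} := by
      rintro ⟨a, b⟩ hab
      simp only [Finset.mem_filter, Finset.mem_univ, true_and] at hab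
      have := st_rev h hab.1 hab.2
      simp [Fin.ext_iff, this.1, this.2]
    simpa using Finset.card_le_card this
  · have : st n m = 1 := by unfold st; rw [dif_neg h]
    rw [this, len_one]; omega

/-- left descent, explicit version -/
def Des (n m : ℕ) (w : Equiv.Perm (Fin n)) : Prop :=
  ∃ h : 0 < m ∧ m < n, w⁻¹ ⟨m, h.2⟩ < w⁻¹ ⟨m - 1, by omega⟩

theorem len_lt_of_des {n m : ℕ} {w : Equiv.Perm (Fin n)} (hd : Des n m w) :
    len n (st n m * w) < len n w := by
  obtain ⟨h, hd⟩ := hd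
  unfold len
  apply Finset.card_lt_card
  rw [Finset.ssubset_iff_of_subset]
  · refine ⟨(w⁻¹ ⟨m, h.2⟩, w⁻¹ ⟨m - 1, by omega⟩), ?_, ?_⟩
    · refine Finset.mem_filter.mpr ⟨Finset.mem_univ _, hd, ?_⟩
      have e1 : w (w⁻¹ ⟨m - 1, by omega⟩) = ⟨m - 1, by omega⟩ := by simp
      have e2 : w (w⁻¹ ⟨m, h.2⟩) = ⟨m, h.2⟩ := by simp
      show w (w⁻¹ ⟨m - 1, by omega⟩) < w (w⁻¹ ⟨m, h.2⟩)
      rw [e1, e2]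
      show m - 1 < m
      omega
    · intro hm
      have hm := (Finset.mem_filter.mp hm).2.2
      have e1 : w (w⁻¹ ⟨m - 1, by omega⟩) = ⟨m - 1, by omega⟩ := by simp
      have e2 : w (w⁻¹ ⟨m, h.2⟩) = ⟨m, h.2⟩ := by simp
      have hm' : st n m (w (w⁻¹ ⟨m - 1, by omega⟩)) < st n m (w (w⁻¹ ⟨m, h.2⟩)) := hm
      rw [e1, e2, Fin.lt_def, st_val h, st_val h] at hm'
      simp only at hm'
      split_ifs at hm' <;> omega
  · rintro ⟨a, b⟩ hab
    replace hab := (Finset.mem_filter.mp hab).2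
    refine Finset.mem_filter.mpr ⟨Finset.mem_univ _, hab.1, ?_⟩
    by_contra hcon
    have hne : w a ≠ w b := fun h' => hab.1.ne (w.injective h')
    have hlt : w a < w b := lt_of_le_of_ne (not_lt.mp hcon) hne
    obtain ⟨h1, h2⟩ := st_rev h hlt hab.2
    have e1 : w⁻¹ ⟨m - 1, by omega⟩ = a := by
      rw [Equiv.Perm.inv_eq_iff_eq]; exact Fin.ext h1.symm
    have e2 : w⁻¹ ⟨m, h.2⟩ = b := by
      rw [Equiv.Perm.inv_eq_iff_eq]; exact Fin.ext h2.symm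
    rw [e1, e2] at hd
    exact absurd hd (not_lt.mpr hab.1.le)

theorem len_of_des {n m : ℕ} {w : Equiv.Perm (Fin n)} (hd : Des n m w) :
    len n (st n m * w) + 1 = len n w := by
  have h1 := len_lt_of_des hd
  have h2 := len_mul_le n (st n m) (st n m * w)
  rw [st_mul_cancel] at h2
  have := len_st_le n m
  omega

theorem des_st_mul {n m : ℕ} (h : 0 < m ∧ m < n) {w : Equiv.Perm (Fin n)} (hd : ¬ Des n m w) :
    Des n m (st n m * w) := by
  refine ⟨h, ?_⟩
  rw [mul_inv_rev, st_inv, Equiv.Perm.mul_apply, Equiv.Perm.mul_apply, st_eq h,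
    Equiv.swap_apply_left, Equiv.swap_apply_right]
  by_contra hcon
  apply hd
  refine ⟨h, lt_of_le_of_ne (not_lt.mp hcon) ?_⟩
  intro h'
  have := (w⁻¹).injective h'
  simp at this; omega

theorem len_of_not_des {n m : ℕ} (h : 0 < m ∧ m < n) {w : Equiv.Perm (Fin n)}
    (hd : ¬ Des n m w) : len n (st n m * w) = len n w + 1 := by
  have := len_of_des (des_st_mul h hd)
  rw [st_mul_cancel] at this
  exact this.symm

theorem len_prod_le (n : ℕ) (L : List ℕ) : len n (L.map (st n)).prod ≤ L.length := by
  induction L with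
  | nil => simp [len_one]
  | cons a L ih =>
    rw [List.map_cons, List.prod_cons, List.length_cons]
    have := len_mul_le n (st n a) (L.map (st n)).prod
    have := len_st_le n a
    omega

theorem eq_one_of_no_des {n : ℕ} (w : Equiv.Perm (Fin n)) (h : ∀ m, ¬ Des n m w) : w = 1 := by
  have hm : StrictMono (⇑(w⁻¹)) := by
    cases n with
    | zero => intro a; exact a.elim0
    | succ n =>
      rw [Fin.strictMono_iff_lt_succ]
      intro i
      by_contra hcon
      apply h (i.1 + 1)
      refine ⟨⟨by omega, by omega⟩, ?_⟩
      refine lt_of_le_of_ne (not_lt.mp hcon) ?_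
      intro h'
      have := (w⁻¹).injective h'
      simp [Fin.ext_iff] at this
  have h1 : (⇑(w⁻¹)) = id :=
    (hm.range_inj strictMono_id).mp (by rw [(w⁻¹).surjective.range_eq, Set.range_id])
  have h2 : w⁻¹ = 1 := by ext x; rw [h1]; rfl
  simpa using h2

theorem red_cons {n m : ℕ} {w : Equiv.Perm (Fin n)} {U : List ℕ} (hd : Des n m w)
    (hU : IsRedWord n U (st n m * w)) : IsRedWord n (m :: U) w := by
  have hl := len_of_des hd
  obtain ⟨h, _⟩ := hd
  refine ⟨?_, ?_, ?_⟩
  · intro i hi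
    rcases List.mem_cons.mp hi with rfl | hi
    · omega
    · exact hU.1 i hi
  · rw [List.map_cons, List.prod_cons, hU.2.1, st_mul_cancel]
  · rw [List.length_cons, hU.2.2, hl]

theorem red_tail {n m : ℕ} {w : Equiv.Perm (Fin n)} {U : List ℕ}
    (hU : IsRedWord n (m :: U) w) : Des n m w ∧ IsRedWord n U (st n m * w) := by
  obtain ⟨h1, h2, h3⟩ := hU
  have hm := h1 m (by simp)
  have h : 0 < m ∧ m < n := by omega
  have hp : (U.map (st n)).prod = st n m * w := by
    rw [← h2, List.map_cons, List.prod_cons, st_mul_cancel]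
  have hl := len_prod_le n U
  rw [hp] at hl
  rw [List.length_cons] at h3
  have hd : Des n m w := by
    by_contra hd
    have := len_of_not_des h hd
    omega
  refine ⟨hd, fun i hi => h1 i (by simp [hi]), hp, ?_⟩
  have := len_of_des hd
  omega

theorem exists_red (n : ℕ) (w : Equiv.Perm (Fin n)) : ∃ L, IsRedWord n L w := by
  induction hN : len n w using Nat.strong_induction_on generalizing w with
  | _ N ih =>
    by_cases h : ∃ m, Des n m w
    · obtain ⟨m, hd⟩ := h
      obtain ⟨U, hU⟩ := ih _ (by rw [← hN]; exact len_lt_of_des hd) (st n m * w) rfl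
      exact ⟨m :: U, red_cons hd hU⟩
    · push Not at h
      have := eq_one_of_no_des w h
      subst this
      exact ⟨[], by simp, by simp, by simp [len_one]⟩

theorem st_comm {n i j : ℕ} (hi : 0 < i ∧ i < n) (hj : 0 < j ∧ j < n) (hij : i + 1 < j) :
    st n i * st n j = st n j * st n i := by
  ext x
  simp only [Equiv.Perm.mul_apply, st_val hi, st_val hj]
  split_ifs <;> omega

theorem st_apply_of_ne {n i : ℕ} (x : Fin n) (h1 : x.1 ≠ i - 1) (h2 : x.1 ≠ i) :
    st n i x = x := by
  by_cases hi : 0 < i ∧ i < n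
  · apply Fin.ext; rw [st_val hi]; simp [h1, h2]
  · unfold st; rw [dif_neg hi]; rfl

theorem st_apply_left {n i : ℕ} (hi : 0 < i ∧ i < n) (x : Fin n) (h1 : x.1 = i - 1) :
    st n i x = ⟨i, hi.2⟩ := by
  apply Fin.ext; rw [st_val hi]; simp [h1]

theorem st_apply_right {n i : ℕ} (hi : 0 < i ∧ i < n) (x : Fin n) (h1 : x.1 = i) :
    st n i x = ⟨i - 1, by omega⟩ := by
  apply Fin.ext; rw [st_val hi]; simp [h1]

theorem st_braid {n i : ℕ} (hi : 0 < i ∧ i < n) (hj : 0 < i + 1 ∧ i + 1 < n) :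
    st n i * (st n (i + 1) * st n i) = st n (i + 1) * (st n i * st n (i + 1)) := by
  apply Equiv.ext
  intro x
  simp only [Equiv.Perm.mul_apply]
  have a1 : st n i ⟨i - 1, by omega⟩ = ⟨i, hi.2⟩ := st_apply_left hi _ rfl
  have a2 : st n i ⟨i, hi.2⟩ = ⟨i - 1, by omega⟩ := st_apply_right hi _ rfl
  have a3 : st n i ⟨i + 1, hj.2⟩ = ⟨i + 1, hj.2⟩ :=
    st_apply_of_ne _ (by simp only; omega) (by simp only; omega)
  have b1 : st n (i + 1) ⟨i, hi.2⟩ = ⟨i + 1, hj.2⟩ := st_apply_left hj _ rfl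
  have b2 : st n (i + 1) ⟨i + 1, hj.2⟩ = ⟨i, hi.2⟩ := st_apply_right hj _ rfl
  have b3 : st n (i + 1) ⟨i - 1, by omega⟩ = ⟨i - 1, by omega⟩ :=
    st_apply_of_ne _ (by simp only; omega) (by simp only; omega)
  by_cases h1 : x.1 = i - 1
  · have hx : x = ⟨i - 1, by omega⟩ := Fin.ext h1
    rw [hx, a1, b1, a3, b3, a1, b1]
  by_cases h2 : x.1 = i
  · have hx : x = ⟨i, hi.2⟩ := Fin.ext h2
    rw [hx, a2, b3, a1, b1, a3, b2]
  by_cases h3 : x.1 = i + 1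
  · have hx : x = ⟨i + 1, hj.2⟩ := Fin.ext h3
    rw [hx, a3, b2, a2, b3]
  have e1 : st n i x = x := st_apply_of_ne _ h1 h2
  have e2 : st n (i + 1) x = x := st_apply_of_ne _ (by omega) h3
  rw [e1, e2, e1, e2]

theorem des_far {n i j : ℕ} {w : Equiv.Perm (Fin n)} (hj : Des n j w)
    (hij : i + 1 < j ∨ j + 1 < i) : Des n j (st n i * w) := by
  obtain ⟨h, hd⟩ := hj
  refine ⟨h, ?_⟩
  rw [mul_inv_rev, st_inv, Equiv.Perm.mul_apply, Equiv.Perm.mul_apply,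
    st_apply_of_ne _ (by simp; omega) (by simp; omega),
    st_apply_of_ne _ (by simp; omega) (by simp; omega)]
  exact hd

theorem mats_aux (n N : ℕ)
    (ih : ∀ N' < N, ∀ (w : Equiv.Perm (Fin n)) (L M : List ℕ), IsRedWord n L w → IsRedWord n M w →
      L.length = N' → ∀ f, demWord n L f = demWord n M f)
    (w : Equiv.Perm (Fin n)) (i j : ℕ) (L M : List ℕ) (hL : IsRedWord n (i :: L) w)
    (hM : IsRedWord n (j :: M) w) (hN : L.length + 1 = N) (hij : i < j) (f) :
    demWord n (i :: L) f = demWord n (j :: M) f := by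
  obtain ⟨di, hL'⟩ := red_tail hL
  obtain ⟨dj, hM'⟩ := red_tail hM
  have hlen : M.length + 1 = N := by
    have h1 := hL.2.2; have h2 := hM.2.2; simp at h1 h2; omega
  obtain ⟨hi, hdi⟩ := id di
  obtain ⟨hj, hdj⟩ := id dj
  show dem n i (demWord n L f) = dem n j (demWord n M f)
  by_cases hfar : i + 1 < j
  · obtain ⟨U, hU⟩ := exists_red n (st n j * (st n i * w))
    have r1 : IsRedWord n (j :: U) (st n i * w) := red_cons (des_far dj (Or.inl hfar)) hU
    have r2 : IsRedWord n (i :: U) (st n j * w) := by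
      apply red_cons (des_far di (Or.inr hfar))
      rwa [← mul_assoc, st_comm hi hj hfar, mul_assoc]
    rw [ih L.length (by omega) _ L _ hL' r1 rfl, ih M.length (by omega) _ M _ hM' r2 rfl]
    exact dem_comm hi hj hfar _
  · have hji : j = i + 1 := by omega
    subst hji
    obtain ⟨U, hU⟩ := exists_red n (st n i * (st n (i + 1) * (st n i * w)))
    have hdj' : w⁻¹ ⟨i + 1, hj.2⟩ < w⁻¹ ⟨i, hi.2⟩ := hdj
    have d1 : Des n (i + 1) (st n i * w) := by
      refine ⟨hj, ?_⟩
      rw [mul_inv_rev, st_inv, Equiv.Perm.mul_apply, Equiv.Perm.mul_apply,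
        st_apply_of_ne _ (by simp; omega) (by simp),
        st_apply_right hi _ (by simp)]
      exact hdj'.trans hdi
    have d2 : Des n i (st n (i + 1) * (st n i * w)) := by
      refine ⟨hi, ?_⟩
      simp only [mul_inv_rev, st_inv, Equiv.Perm.mul_apply]
      rw [st_apply_left hj ⟨i, hi.2⟩ (by simp),
        st_apply_of_ne (i := i + 1) _ (by simp; omega) (by simp),
        st_apply_left hi ⟨i - 1, by omega⟩ (by simp),
        st_apply_of_ne _ (by simp; omega) (by simp)]
      exact hdj'
    have d3 : Des n i (st n (i + 1) * w) := by
      refine ⟨hi, ?_⟩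
      rw [mul_inv_rev, st_inv, Equiv.Perm.mul_apply, Equiv.Perm.mul_apply,
        st_apply_left hj ⟨i, hi.2⟩ (by simp),
        st_apply_of_ne _ (by simp; omega) (by simp)]
      exact hdj'.trans hdi
    have d4 : Des n (i + 1) (st n i * (st n (i + 1) * w)) := by
      refine ⟨hj, ?_⟩
      simp only [mul_inv_rev, st_inv, Equiv.Perm.mul_apply]
      have e1 : st n i (⟨i + 1, hj.2⟩ : Fin n) = ⟨i + 1, hj.2⟩ :=
        st_apply_of_ne _ (by simp; omega) (by simp)
      have e2 : st n i (⟨i + 1 - 1, by omega⟩ : Fin n) = ⟨i - 1, by omega⟩ :=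
        st_apply_right hi _ (by simp)
      have e3 : st n (i + 1) (⟨i + 1, hj.2⟩ : Fin n) = ⟨i, hi.2⟩ :=
        st_apply_right hj _ rfl
      have e4 : st n (i + 1) (⟨i - 1, by omega⟩ : Fin n) = ⟨i - 1, by omega⟩ :=
        st_apply_of_ne _ (by simp; omega) (by simp)
      rw [e1, e2, e3, e4]
      exact hdi
    have r1 : IsRedWord n ((i + 1) :: i :: U) (st n i * w) := red_cons d1 (red_cons d2 hU)
    have r2 : IsRedWord n (i :: (i + 1) :: U) (st n (i + 1) * w) := by
      apply red_cons d3
      apply red_cons d4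
      have hb := st_braid hi hj
      have : st n (i + 1) * (st n i * (st n (i + 1) * w)) =
          st n i * (st n (i + 1) * (st n i * w)) := by
        have := congrArg (· * w) hb
        simp only [mul_assoc] at this
        exact this.symm
      rw [this]; exact hU
    rw [ih L.length (by omega) _ L _ hL' r1 rfl, ih M.length (by omega) _ M _ hM' r2 rfl]
    exact dem_braid hi hj _

/-- Matsumoto: `π_w` does not depend on the reduced word. -/
theorem mats (n N : ℕ) : ∀ (w : Equiv.Perm (Fin n)) (L M : List ℕ), IsRedWord n L w →
    IsRedWord n M w → L.length = N → ∀ f, demWord n L f = demWord n M f := by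
  induction N using Nat.strong_induction_on with
  | _ N ih =>
    intro w L M hL hM hN f
    have hll : L.length = M.length := by rw [hL.2.2, hM.2.2]
    match L, M, hL, hM, hN, hll with
    | [], [], _, _, _, _ => rfl
    | i :: L, j :: M, hL, hM, hN, hll =>
      rcases lt_trichotomy i j with h | h | h
      · exact mats_aux n N ih w i j L M hL hM (by simpa using hN) h f
      · subst h
        show dem n i (demWord n L f) = dem n i (demWord n M f)
        have hN' : L.length + 1 = N := by simpa using hN
        rw [ih L.length (by omega) _ L M (red_tail hL).2 (red_tail hM).2 rfl]
      · have hN' : M.length + 1 = N := by rw [← hN, hll]; simp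
        exact (mats_aux n N ih w j i M L hM hL hN' h f).symm

/-- a right descent letter can be moved to the end of a reduced word -/
theorem demWord_right_kill {n m : ℕ} (w : Equiv.Perm (Fin n)) (L : List ℕ) (hL : IsRedWord n L w)
    (h : 0 < m ∧ m < n) (hw : len n (w * st n m) ≤ len n w) (f) (hf : dem n m f = 0) :
    demWord n L f = 0 := by
  obtain ⟨U, hU⟩ := exists_red n (w * st n m)
  have hlen : len n (w * st n m) + 1 = len n w := by
    have e : (w * st n m)⁻¹ = st n m * w⁻¹ := by rw [mul_inv_rev, st_inv]
    have e' := len_inv n (w * st n m)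
    rw [e] at e'
    rw [← e', ← len_inv n w]
    rw [← e', ← len_inv n w] at hw
    apply len_of_des
    by_contra hd
    have := len_of_not_des h hd
    omega
  have hr : IsRedWord n (U ++ [m]) w := by
    refine ⟨?_, ?_, ?_⟩
    · intro i hi
      rcases List.mem_append.mp hi with hi | hi
      · exact hU.1 i hi
      · simp at hi; omega
    · rw [List.map_append, List.prod_append, hU.2.1]
      simp [mul_assoc, st_mul_self]
    · rw [List.length_append, hU.2.2]; simpa using hlen
  rw [mats n _ w L _ hL hr rfl, demWord_append]
  show demWord n U (dem n m f) = 0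
  rw [hf, demWord_zero]

end PartM

end LSS

open scoped Classical

namespace LSS

section PartS
open MvPolynomial

theorem mono_mul (n : ℕ) (u v : Fin n → ℕ) : mono n u * mono n v = mono n (fun k => u k + v k) := by
  unfold mono
  rw [monomial_mul, one_mul]
  refine congrArg (fun z => monomial z (1 : ℤ)) ?_
  ext k
  rfl

theorem X_eq_mono (n : ℕ) (a : Fin n) :
    (X a : MvPolynomial (Fin n) ℤ) = mono n (fun k => if k = a then 1 else 0) := by
  unfold mono X
  refine congrArg (fun z => monomial z (1 : ℤ)) ?_
  ext k
  simp [expOf, Finsupp.single_apply, eq_comm]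

theorem rename_mono (n : ℕ) (σ : Equiv.Perm (Fin n)) (u : Fin n → ℕ) :
    rename (⇑σ) (mono n u) = mono n (fun k => u (σ⁻¹ k)) := by
  unfold mono
  rw [rename_monomial]
  refine congrArg (fun z => monomial z (1 : ℤ)) ?_
  ext k
  rw [← Finsupp.equivMapDomain_eq_mapDomain]
  simp [expOf, Finsupp.equivMapDomain_apply]

theorem adj_swap {n m : ℕ} (h : 0 < m ∧ m < n) (b : Fin n → ℕ) :
    dem n m (mono n (fun k => b k + k.1) + mono n (fun k => b (st n m k) + k.1)) = 0 := by
  have key : ∀ b : Fin n → ℕ, X (⟨m - 1, by omega⟩ : Fin n) * mono n (fun k => b k + k.1) =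
      X (⟨m, h.2⟩ : Fin n) * rename (⇑(st n m)) (mono n (fun k => b (st n m k) + k.1)) := by
    intro b
    rw [rename_mono, st_inv, X_eq_mono, X_eq_mono, mono_mul, mono_mul]
    congr 1
    funext k
    have : st n m (st n m k) = k := by
      rw [← Equiv.Perm.mul_apply, st_mul_self]; rfl
    rw [this, st_val h]
    simp only [Fin.ext_iff]
    split_ifs <;> omega
  apply dem_eq_zero h
  rw [← st_eq h, map_add, mul_add, mul_add, key b, key (fun k => b (st n m k)), add_comm]
  have : (fun k : Fin n => b (st n m (st n m k)) + k.1) = fun k => b k + k.1 := by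
    funext k
    have : st n m (st n m k) = k := by
      rw [← Equiv.Perm.mul_apply, st_mul_self]; rfl
    rw [this]
  simp only [this]

theorem word_adj {n : ℕ} {I : Set ℕ} {w : Equiv.Perm (Fin n)} (hw : IsLongest n I w)
    {L : List ℕ} (hL : IsRedWord n L w) {m : ℕ} (h : 0 < m ∧ m < n) (hm : m ∈ I) (b : Fin n → ℕ) :
    demWord n L (mono n (fun k => b (st n m k) + k.1)) =
      - demWord n L (mono n (fun k => b k + k.1)) := by
  have h1 : len n (w * st n m) ≤ len n w :=
    hw.2 _ (mul_mem hw.1 (Subgroup.subset_closure ⟨m, hm, rfl⟩))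
  have := demWord_right_kill w L hL h h1 _ (adj_swap h b)
  rw [demWord_add] at this
  exact eq_neg_of_add_eq_zero_right this

theorem word_swap {n : ℕ} {I : Set ℕ} {w : Equiv.Perm (Fin n)} (hw : IsLongest n I w)
    {L : List ℕ} (hL : IsRedWord n L w) (g : ℕ) : ∀ (i j : Fin n), j.1 = i.1 + g + 1 →
    (∀ m, i.1 < m → m ≤ j.1 → m ∈ I) → ∀ b : Fin n → ℕ,
    demWord n L (mono n (fun k => b (Equiv.swap i j k) + k.1)) =
      - demWord n L (mono n (fun k => b k + k.1)) := by
  induction g with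
  | zero =>
    intro i j hij hI b
    have h : 0 < j.1 ∧ j.1 < n := ⟨by omega, j.2⟩
    have := word_adj hw hL h (hI j.1 (by omega) le_rfl) b
    rw [st_eq h] at this
    have e : (⟨j.1 - 1, by omega⟩ : Fin n) = i := Fin.ext (by simp only; omega)
    rw [e] at this
    exact this
  | succ g ih =>
    intro i j hij hI b
    have h : 0 < i.1 + 1 ∧ i.1 + 1 < n := ⟨by omega, by omega⟩
    have hk := word_adj hw hL h (hI (i.1 + 1) (by omega) (by omega))
    rw [st_eq h] at hk
    set kk : Fin n := ⟨i.1 + 1, h.2⟩ with hkk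
    have e : (⟨i.1 + 1 - 1, by omega⟩ : Fin n) = i := Fin.ext (by simp)
    rw [e] at hk
    have h2 := ih kk j (by simp only [hkk]; omega) (fun m h1 h2 => hI m (by simp only [hkk] at h1; omega) h2)
    have hik : i ≠ kk := by rw [Ne, Fin.ext_iff]; simp [hkk]
    have hij' : i ≠ j := by rw [Ne, Fin.ext_iff]; omega
    have hkj : kk ≠ j := by rw [Ne, Fin.ext_iff]; simp only [hkk]; omega
    have e2 : ∀ x, Equiv.swap i j x = Equiv.swap i kk (Equiv.swap kk j (Equiv.swap i kk x)) := by
      intro x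
      by_cases h1 : x = i
      · subst h1
        rw [Equiv.swap_apply_left, Equiv.swap_apply_left, Equiv.swap_apply_left,
          Equiv.swap_apply_of_ne_of_ne hij'.symm hkj.symm]
      by_cases h2 : x = j
      · subst h2
        rw [Equiv.swap_apply_right, Equiv.swap_apply_of_ne_of_ne hij'.symm hkj.symm,
          Equiv.swap_apply_right, Equiv.swap_apply_right]
      by_cases h3 : x = kk
      · rw [h3, Equiv.swap_apply_right, Equiv.swap_apply_of_ne_of_ne hik hij',
          Equiv.swap_apply_left, Equiv.swap_apply_of_ne_of_ne hik.symm hkj]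
      · rw [Equiv.swap_apply_of_ne_of_ne h1 h2, Equiv.swap_apply_of_ne_of_ne h1 h3,
          Equiv.swap_apply_of_ne_of_ne h3 h2, Equiv.swap_apply_of_ne_of_ne h1 h3]
    simp only [e2]
    rw [hk (fun k => b (Equiv.swap i kk (Equiv.swap kk j k))), h2 (fun k => b (Equiv.swap i kk k)),
      hk b, neg_neg]

theorem word_tmv {n : ℕ} {I : Set ℕ} {w : Equiv.Perm (Fin n)} (hw : IsLongest n I w)
    {L : List ℕ} (hL : IsRedWord n L w) {i j : Fin n} (hij : i < j)
    (hI : ∀ m, i.1 < m → m ≤ j.1 → m ∈ I) (β : Fin n → ℤ) (h1 : ∀ k, 0 ≤ β k)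
    (h2 : ∀ k, 0 ≤ tmv n i j β k) :
    demWord n L (mono n (toNatV n (tmv n i j β))) = - demWord n L (mono n (toNatV n β)) := by
  have hij' := Fin.lt_def.mp hij
  have key := word_swap hw hL (j.1 - i.1 - 1) i j (by omega) hI (fun k => (β k).toNat + n - k.1)
  have hsym : ∀ a b : Fin n, rename (⇑(Equiv.swap a b)) (mono n fun _ => n) = mono n fun _ => n := by
    intro a b; rw [rename_mono]
  have e1 : mono n (fun k : Fin n => (β k).toNat + n - k.1 + k.1) =
      mono n (fun _ => n) * mono n (toNatV n β) := by
    rw [mono_mul]; congr 1; funext k; unfold toNatV; have := k.2; omega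
  have e2 : mono n (fun k : Fin n => (β (Equiv.swap i j k)).toNat + n - (Equiv.swap i j k).1 + k.1) =
      mono n (fun _ => n) * mono n (toNatV n (tmv n i j β)) := by
    rw [mono_mul]; congr 1; funext k
    have g := h2 k
    have g1 := h1 i
    have g2 := h1 j
    have g3 := i.2
    have g4 := j.2
    have g5 := k.2
    unfold toNatV
    unfold tmv gapZ at g ⊢
    rw [Equiv.swap_apply_def]
    by_cases c1 : k = i
    · subst c1
      simp only [if_true] at g ⊢
      omega
    · by_cases c2 : k = j
      · subst c2
        simp only [if_true, if_neg c1] at g ⊢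
        omega
      · simp only [if_neg c1, if_neg c2] at g ⊢
        omega
  rw [e1, e2, demWord_sym_mul n L _ _ hsym, demWord_sym_mul n L _ _ hsym, ← mul_neg] at key
  refine mul_left_cancel₀ ?_ key
  unfold mono
  rw [Ne, monomial_eq_zero]
  exact one_ne_zero

end PartS

end LSS

open scoped Classical

namespace LSS

section PartK
open MvPolynomial

theorem prod_preserve {n e : ℕ} (T : List ℕ) (hT : e ∉ T) (x : Fin n) :
    ((T.map (st n)).prod x).1 < e ↔ x.1 < e := by
  induction T with
  | nil => simp
  | cons m T ih =>
    rw [List.map_cons, List.prod_cons, Equiv.Perm.mul_apply]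
    have h1 : e ≠ m := fun h => hT (by simp [h])
    rw [← ih (fun h => hT (by simp [h]))]
    set y := (T.map (st n)).prod x
    by_cases hm : 0 < m ∧ m < n
    · rw [st_val hm]; split_ifs <;> omega
    · unfold st; rw [dif_neg hm]; rfl

theorem prod_inv_preserve {n e : ℕ} (T : List ℕ) (hT : e ∉ T) (x : Fin n) :
    (((T.map (st n)).prod)⁻¹ x).1 < e ↔ x.1 < e := by
  rw [← prod_preserve T hT (((T.map (st n)).prod)⁻¹ x)]
  simp

theorem cox_peel {n m : ℕ} (L : List ℕ) (hnd : L.Nodup) (hr : ∀ i ∈ L, 1 ≤ i ∧ i ≤ n - 1)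
    (hd : Des n m (L.map (st n)).prod) :
    m ∈ L ∧ (L.map (st n)).prod = st n m * ((L.erase m).map (st n)).prod := by
  induction L with
  | nil =>
    obtain ⟨h, hd⟩ := hd
    exfalso
    simp at hd
    omega
  | cons h T ih =>
    by_cases hm : h = m
    · subst hm; simp
    · have hnd' := List.nodup_cons.mp hnd
      have hh := hr h (by simp)
      have hrT : ∀ i ∈ T, 1 ≤ i ∧ i ≤ n - 1 := fun i hi => hr i (by simp [hi])
      rw [List.map_cons, List.prod_cons] at hd ⊢
      have hhr : 0 < h ∧ h < n := by omega
      by_cases hfar : h + 1 < m ∨ m + 1 < h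
      · have d2 := des_far (i := h) hd hfar
        rw [st_mul_cancel] at d2
        obtain ⟨i1, i2⟩ := ih hnd'.2 hrT d2
        refine ⟨by simp [i1], ?_⟩
        rw [List.erase_cons_tail (by simpa using hm), List.map_cons, List.prod_cons, i2,
          ← mul_assoc, ← mul_assoc]
        obtain ⟨hmr, _⟩ := hd
        rcases hfar with hf | hf
        · rw [st_comm hhr hmr hf]
        · rw [st_comm hmr hhr hf]
      · exfalso
        obtain ⟨hmr, hd⟩ := hd
        rw [mul_inv_rev, st_inv, Equiv.Perm.mul_apply, Equiv.Perm.mul_apply, Fin.lt_def] at hd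
        have key := prod_inv_preserve (n := n) (e := h) T hnd'.1
        rcases (show h = m + 1 ∨ m = h + 1 by omega) with hc | hc
        · subst hc
          rw [st_apply_left hhr ⟨m, hmr.2⟩ (by simp),
            st_apply_of_ne ⟨m - 1, by omega⟩ (by simp; omega) (by simp)] at hd
          have k1 := (key ⟨m - 1, by omega⟩).mpr (by simp only; omega)
          have k2 := (key ⟨m + 1, hhr.2⟩).not.mpr (by simp)
          omega
        · subst hc
          rw [st_apply_of_ne ⟨h + 1, hmr.2⟩ (by simp; omega) (by simp),
            st_apply_right hhr ⟨h + 1 - 1, by omega⟩ (by simp)] at hd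
          have k1 := (key ⟨h - 1, by omega⟩).mpr (by simp only; omega)
          have k2 := (key ⟨h + 1, hmr.2⟩).not.mpr (by simp)
          omega

/-- strict Demazure words for the composition `α` built from `lam` -/
inductive KW (n : ℕ) (lam : Fin n → ℕ) : (Fin n → ℕ) → List ℕ → Prop
  | nil : KW n lam lam []
  | cons (a : Fin n → ℕ) (L : List ℕ) (m : ℕ) (h : KW n lam a L)
      (hm : 1 ≤ m ∧ m < n) (hlt : ent n a m < ent n a (m - 1)) (hmem : m ∉ L) :
      KW n lam (swapAt n (m - 1) a) (m :: L)

theorem KW_nodup {n : ℕ} {lam a : Fin n → ℕ} {L : List ℕ} (h : KW n lam a L) :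
    L.Nodup ∧ ∀ m ∈ L, 1 ≤ m ∧ m < n := by
  induction h with
  | nil => simp
  | cons a L m h hm hlt hmem ih =>
    refine ⟨List.nodup_cons.mpr ⟨hmem, ih.1⟩, ?_⟩
    intro x hx
    rcases List.mem_cons.mp hx with rfl | hx
    · exact hm
    · exact ih.2 x hx

theorem ent_lt {n : ℕ} (α : Fin n → ℕ) {p : ℕ} (h : p < n) : ent n α p = α ⟨p, h⟩ := by
  unfold ent; rw [dif_pos h]

theorem ent_swapAt {n : ℕ} (α : Fin n → ℕ) {m : ℕ} (hm : 1 ≤ m ∧ m < n) (p : ℕ) :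
    ent n (swapAt n (m - 1) α) p =
      if p = m - 1 then ent n α m else if p = m then ent n α (m - 1) else ent n α p := by
  have e : m - 1 + 1 = m := by omega
  by_cases hp : p < n
  · rw [ent_lt _ hp]
    unfold swapAt
    simp only [e]
    split_ifs <;> first | rfl | rw [ent_lt _ hp]
  · unfold ent; rw [dif_neg hp, dif_neg hp, if_neg (by omega), if_neg (by omega)]

theorem KW_sink {n : ℕ} {lam a : Fin n → ℕ} {L : List ℕ} (h : KW n lam a L) :
    ∀ m ∈ L, (∀ m' ∈ L, (m' = m + 1 ∨ m' + 1 = m) → L.idxOf m < L.idxOf m') →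
      ent n a (m - 1) < ent n a m := by
  induction h with
  | nil => simp
  | cons a L m0 h hm hlt hmem ih =>
    intro m hmL hnb
    by_cases hmm : m = m0
    · subst hmm
      rw [ent_swapAt a hm, ent_swapAt a hm, if_pos rfl, if_neg (by omega), if_pos rfl]
      exact hlt
    · have hmT : m ∈ L := by
        rcases List.mem_cons.mp hmL with h' | h'
        · exact absurd h' hmm
        · exact h'
      have hne : ¬ (m0 = m + 1 ∨ m0 + 1 = m) := by
        intro hc
        have := hnb m0 (by simp) hc
        simp at this
      have hm1 := (KW_nodup h).2 m hmT
      rw [ent_swapAt a hm, ent_swapAt a hm, if_neg (by omega), if_neg (by omega),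
        if_neg (by omega), if_neg (by omega)]
      apply ih m hmT
      intro m' hm' hc
      have := hnb m' (by simp [hm']) hc
      have hne' : m' ≠ m0 := fun h' => hmem (h' ▸ hm')
      rw [List.idxOf_cons_ne _ (Ne.symm hmm), List.idxOf_cons_ne _ (Ne.symm hne')] at this
      omega

theorem pact_st {n m : ℕ} (hm : 0 < m ∧ m < n) (c : Equiv.Perm (Fin n)) (lam : Fin n → ℕ) :
    pact n (st n m * c) lam = swapAt n (m - 1) (pact n c lam) := by
  funext x
  unfold pact
  rw [mul_inv_rev, st_inv, Equiv.Perm.mul_apply]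
  unfold swapAt
  have e : m - 1 + 1 = m := by omega
  rw [e, ent_lt _ hm.2, ent_lt _ (show m - 1 < n by omega)]
  by_cases h1 : x.1 = m - 1
  · rw [if_pos h1, st_apply_left hm x h1]
  · by_cases h2 : x.1 = m
    · rw [if_neg h1, if_pos h2, st_apply_right hm x h2]
    · rw [if_neg h1, if_neg h2, st_apply_of_ne x h1 h2]

theorem no_ascent {n : ℕ} (c : Equiv.Perm (Fin n)) (lam : Fin n → ℕ) (hlam : IsPartition n lam)
    (h : ¬ ∃ p : Fin n, ent n (pact n c lam) p.1 < ent n (pact n c lam) (p.1 + 1)) :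
    pact n c lam = lam := by
  have h1 : Antitone (lam ∘ ⇑(c⁻¹)) := by
    cases n with
    | zero => intro a; exact a.elim0
    | succ n =>
      rw [Fin.antitone_iff_succ_le]
      intro i
      push Not at h
      have := h i.castSucc
      rw [ent_lt _ (show i.castSucc.1 + 1 < n + 1 by simp), ent_lt _ i.castSucc.2] at this
      exact this
  have h2 : Antitone (lam ∘ ⇑(1 : Equiv.Perm (Fin n))) := fun a b hab => hlam a b hab
  exact Tuple.unique_antitone h1 h2

theorem key_word {n : ℕ} (lam : Fin n → ℕ) (hlam : IsPartition n lam) (k : ℕ) :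
    ∀ L : List ℕ, L.Nodup → (∀ i ∈ L, 1 ≤ i ∧ i ≤ n - 1) → L.length ≤ k →
    ∃ L' : List ℕ, L' ⊆ L ∧ KW n lam (pact n (L.map (st n)).prod lam) L' ∧
      keyAux n k (pact n (L.map (st n)).prod lam) = demWord n L' (mono n lam) := by
  induction k with
  | zero =>
    intro L _ _ hl
    have : L = [] := List.eq_nil_of_length_eq_zero (by omega)
    subst this
    have e : pact n (([] : List ℕ).map (st n)).prod lam = lam := by
      funext x; simp [pact]
    rw [e]
    exact ⟨[], by simp, KW.nil, rfl⟩
  | succ k ih =>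
    intro L hnd hr hl
    set c := (L.map (st n)).prod with hc
    unfold keyAux
    split_ifs with h
    · set p := h.choose with hp
      have hsp := h.choose_spec
      rw [← hp] at hsp
      have hpn : p.1 + 1 < n := by
        by_contra hcon
        have : ent n (pact n c lam) (p.1 + 1) = 0 := by unfold ent; rw [dif_neg hcon]
        omega
      have hm : 0 < p.1 + 1 ∧ p.1 + 1 < n := ⟨by omega, hpn⟩
      have hdes : Des n (p.1 + 1) c := by
        refine ⟨hm, ?_⟩
        by_contra hcon
        have := hlam _ _ (not_lt.mp hcon)
        rw [ent_lt _ p.2, ent_lt _ hpn] at hsp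
        unfold pact at hsp
        exact absurd hsp (not_lt.mpr this)
      obtain ⟨hmL, hce⟩ := cox_peel L hnd hr hdes
      have hlen := List.length_erase_of_mem hmL
      have hpos := List.length_pos_of_mem hmL
      obtain ⟨L', h1, h2, h3⟩ := ih (L.erase (p.1 + 1)) (hnd.erase _)
        (fun i hi => hr i (List.mem_of_mem_erase hi)) (by omega)
      set c' := ((L.erase (p.1 + 1)).map (st n)).prod with hc'
      have e1 : swapAt n p.1 (pact n c lam) = pact n c' lam := by
        have := pact_st hm c lam
        rw [Nat.add_sub_cancel] at this
        rw [← this, hc, hce, st_mul_cancel]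
      have e2 : pact n c lam = swapAt n (p.1 + 1 - 1) (pact n c' lam) := by
        rw [← pact_st hm c' lam, ← hce]
      refine ⟨(p.1 + 1) :: L', ?_, ?_, ?_⟩
      · intro x hx
        rcases List.mem_cons.mp hx with rfl | hx
        · exact hmL
        · exact List.mem_of_mem_erase (h1 hx)
      · rw [e2]
        refine KW.cons _ _ _ h2 ⟨by omega, hpn⟩ ?_ ?_
        · rw [e2, ent_swapAt _ ⟨by omega, hpn⟩, ent_swapAt _ ⟨by omega, hpn⟩] at hsp
          simpa using hsp
        · intro hx
          exact (hnd.mem_erase_iff.mp (h1 hx)).1 rfl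
      · rw [e1, h3]; rfl
    · refine ⟨[], by simp, ?_, ?_⟩
      · rw [no_ascent c lam hlam h]; exact KW.nil
      · rw [no_ascent c lam hlam h]; rfl

theorem longest_no_des {n : ℕ} {I : Set ℕ} {w c : Equiv.Perm (Fin n)} (hw : IsLongest n I w)
    (hlen : len n (w * c) = len n w + len n c) {m : ℕ} (hm : m ∈ I) : ¬ Des n m c := by
  intro hd
  have h1 := len_of_des hd
  have h2 : len n (w * st n m) ≤ len n w :=
    hw.2 _ (mul_mem hw.1 (Subgroup.subset_closure ⟨m, hm, rfl⟩))
  have h3 := len_mul_le n (w * st n m) (st n m * c)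
  rw [mul_assoc, st_mul_cancel] at h3
  omega

end PartK

end LSS

open scoped Classical

namespace LSS

section PartV
open MvPolynomial

/-- the flow inequalities describing the support of a Demazure word -/
def Valid (lam : ℕ → ℤ) (L : List ℕ) (t : ℕ → ℤ) : Prop :=
  (∀ m, m ∉ L → t m = 0) ∧ ∀ m ∈ L, 0 ≤ t m ∧ t m ≤ lam (m - 1) - lam m +
    (if L.idxOf m < L.idxOf (m - 1) then t (m - 1) else 0) +
    (if L.idxOf m < L.idxOf (m + 1) then t (m + 1) else 0)

theorem valid_nonneg {lam : ℕ → ℤ} {L : List ℕ} {t : ℕ → ℤ} (h : Valid lam L t) (m : ℕ) :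
    0 ≤ t m := by
  by_cases hm : m ∈ L
  · exact (h.2 m hm).1
  · rw [h.1 m hm]

theorem ite_shift (T : List ℕ) (m m' x : ℕ) (t : ℕ → ℤ) (hmT : m ∉ T) (hm' : m' ∈ T) :
    (if (m :: T).idxOf m' < (m :: T).idxOf x then t x else 0) =
    (if T.idxOf m' < T.idxOf x then Function.update t m 0 x else 0) := by
  have hne : m ≠ m' := fun h => hmT (h ▸ hm')
  rw [List.idxOf_cons_ne _ hne]
  by_cases hx : x = m
  · subst hx
    simp
  · rw [List.idxOf_cons_ne _ (Ne.symm hx), Function.update_of_ne hx]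
    simp only [Nat.succ_eq_add_one, Nat.add_lt_add_iff_right]

theorem valid_cons {lam : ℕ → ℤ} {T : List ℕ} {t : ℕ → ℤ} {m : ℕ} (hm : 1 ≤ m) (hmT : m ∉ T) :
    Valid lam (m :: T) t ↔ Valid lam T (Function.update t m 0) ∧ 0 ≤ t m ∧
      t m ≤ lam (m - 1) - lam m + t (m - 1) + t (m + 1) := by
  have hidx : ∀ x, x ≠ m → ((m :: T).idxOf m < (m :: T).idxOf x) := by
    intro x hx
    rw [List.idxOf_cons_self, List.idxOf_cons_ne _ (Ne.symm hx)]; omega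
  constructor
  · rintro ⟨h1, h2⟩
    have hmm := h2 m (by simp)
    rw [if_pos (hidx _ (by omega)), if_pos (hidx _ (by omega))] at hmm
    refine ⟨⟨?_, ?_⟩, hmm⟩
    · intro x hx
      by_cases hxm : x = m
      · subst hxm; simp
      · rw [Function.update_of_ne hxm]; exact h1 x (by simp [hxm, hx])
    · intro x hx
      have hxm : x ≠ m := fun h => hmT (h ▸ hx)
      have := h2 x (by simp [hx])
      rw [ite_shift T m x _ t hmT hx, ite_shift T m x _ t hmT hx] at this
      rw [Function.update_of_ne hxm]
      exact this
  · rintro ⟨⟨h1, h2⟩, hmm⟩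
    refine ⟨?_, ?_⟩
    · intro x hx
      have hxm : x ≠ m := fun h => hx (by simp [h])
      have := h1 x (fun h => hx (by simp [h]))
      rwa [Function.update_of_ne hxm] at this
    · intro x hx
      by_cases hxm : x = m
      · subst hxm
        rw [if_pos (hidx _ (by omega)), if_pos (hidx _ (by omega))]
        exact hmm
      · have hxT : x ∈ T := by
          rcases List.mem_cons.mp hx with h' | h'
          · exact absurd h' hxm
          · exact h'
        have := h2 x hxT
        rw [Function.update_of_ne hxm] at this
        rw [ite_shift T m x _ t hmT hxT, ite_shift T m x _ t hmT hxT]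
        exact this

theorem valid_vec_nonneg {n : ℕ} (lam : ℕ → ℤ) (hl : ∀ p, 0 ≤ lam p) (L : List ℕ)
    (hnd : L.Nodup) (hr : ∀ m ∈ L, 1 ≤ m ∧ m < n) :
    ∀ t, Valid lam L t → ∀ p, 0 ≤ lam p + t p - t (p + 1) := by
  induction L with
  | nil =>
    intro t ht p
    rw [ht.1 p (by simp), ht.1 (p + 1) (by simp)]
    have := hl p
    omega
  | cons m T ih =>
    intro t ht p
    have hnd' := List.nodup_cons.mp hnd
    have hm := hr m (by simp)
    obtain ⟨h1, h2, h3⟩ := (valid_cons hm.1 hnd'.1).mp ht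
    have ih' := ih hnd'.2 (fun x hx => hr x (by simp [hx])) _ h1
    have ihp := ih' p
    by_cases c1 : p = m
    · subst c1
      rw [Function.update_self, Function.update_of_ne (by omega)] at ihp
      omega
    · by_cases c2 : p + 1 = m
      · subst c2
        have i2 := ih' (p + 1)
        rw [Function.update_self, Function.update_of_ne (by omega)] at i2 ihp
        rw [Nat.add_sub_cancel] at h3
        omega
      · rw [Function.update_of_ne c1, Function.update_of_ne c2] at ihp
        exact ihp

/-- `s` is the exponent vector with flow `t` -/
def FlowVec (n : ℕ) (lam : Fin n → ℕ) (s : Fin n →₀ ℕ) (t : ℕ → ℤ) : Prop :=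
  ∀ p : Fin n, (s p : ℤ) = (ent n lam p.1 : ℤ) + t p.1 - t (p.1 + 1)

theorem word_support {n : ℕ} (lam : Fin n → ℕ) (hlam : IsPartition n lam) (L : List ℕ)
    (hnd : L.Nodup) (hr : ∀ m ∈ L, 1 ≤ m ∧ m < n) :
    (∀ s, 0 ≤ coeff s (demWord n L (mono n lam))) ∧
    ∀ s, coeff s (demWord n L (mono n lam)) ≠ 0 ↔
      ∃ t, FlowVec n lam s t ∧ Valid (fun p => (ent n lam p : ℤ)) L t := by
  induction L with
  | nil =>
    have e : demWord n [] (mono n lam) = monomial (expOf n lam) 1 := rfl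
    rw [e]
    simp only [coeff_monomial]
    refine ⟨fun s => by split_ifs <;> simp, fun s => ?_⟩
    constructor
    · intro h
      have hs : expOf n lam = s := by by_contra hc; rw [if_neg hc] at h; exact h rfl
      refine ⟨fun _ => 0, ?_, ?_, ?_⟩
      · intro p
        rw [← hs, ent_lt _ p.2]
        simp [expOf]
      · intros; rfl
      · intro m hm; simp at hm
    · rintro ⟨t, h1, h2⟩
      have hs : expOf n lam = s := by
        ext p
        have := h1 p
        rw [h2.1 _ (by simp), h2.1 _ (by simp), ent_lt _ p.2] at this
        simp [expOf]
        simp at this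
        exact this.symm
      rw [if_pos hs]; simp
  | cons m T ih =>
    have hnd' := List.nodup_cons.mp hnd
    have hm := hr m (by simp)
    have hrT : ∀ x ∈ T, 1 ≤ x ∧ x < n := fun x hx => hr x (by simp [hx])
    obtain ⟨ih1, ih2⟩ := ih hnd'.2 hrT
    have hm' : 0 < m ∧ m < n := ⟨by omega, hm.2⟩
    have hm1 : m - 1 < n := by omega
    have hmm : m - 1 + 1 = m := by omega
    have hl : ent n lam m ≤ ent n lam (m - 1) := by
      rw [ent_lt _ hm.2, ent_lt _ hm1]
      apply hlam
      rw [Fin.le_def]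
      simp
    have hdom : ∀ s, coeff s (demWord n T (mono n lam)) ≠ 0 →
        s ⟨m, hm'.2⟩ ≤ s ⟨m - 1, by omega⟩ := by
      intro s hs
      obtain ⟨t, f1, v1⟩ := (ih2 s).mp hs
      have a1 := f1 ⟨m, hm.2⟩
      have a2 := f1 ⟨m - 1, hm1⟩
      simp only [hmm] at a1 a2
      rw [v1.1 m hnd'.1] at a1 a2
      have b1 := valid_nonneg v1 (m - 1)
      have b2 := valid_nonneg v1 (m + 1)
      omega
    obtain ⟨d1, d2⟩ := dem_coeff hm' (demWord n T (mono n lam)) ih1 hdom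
    refine ⟨d1, fun s => ?_⟩
    show coeff s (dem n m (demWord n T (mono n lam))) ≠ 0 ↔ _
    rw [d2 s]
    constructor
    · rintro ⟨s0, hs0, t0, ht0, rfl⟩
      have hd0 := hdom s0 hs0
      obtain ⟨t, f1, v1⟩ := (ih2 s0).mp hs0
      have a1 := f1 ⟨m, hm.2⟩
      have a2 := f1 ⟨m - 1, hm1⟩
      simp only [hmm] at a1 a2
      have tm := v1.1 m hnd'.1
      rw [tm] at a1 a2
      refine ⟨Function.update t m t0, ?_, (valid_cons hm.1 hnd'.1).mpr ⟨?_, ?_, ?_⟩⟩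
      · intro p
        have hp := f1 p
        simp only [Finsupp.coe_add, Finsupp.coe_tsub, Pi.add_apply, Pi.sub_apply,
          Finsupp.single_apply, Fin.ext_iff, Function.update_apply]
        by_cases c1 : p.1 = m
        · rw [if_neg (by omega), if_pos c1.symm, if_pos c1, if_neg (by omega)]
          rw [c1, tm] at hp
          rw [c1]
          push_cast
          omega
        · by_cases c2 : p.1 + 1 = m
          · have : p = ⟨m - 1, hm1⟩ := Fin.ext (by simp only; omega)
            rw [if_pos (by omega), if_neg (by omega), if_neg (by omega), if_pos c2]
            rw [c2, tm] at hp
            rw [this] at hp ⊢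
            simp only at hp ⊢
            omega
          · rw [if_neg (by omega), if_neg (by omega), if_neg (by omega), if_neg (by omega)]
            omega
      · rw [Function.update_idem]
        have : Function.update t m 0 = t := by rw [← tm]; exact Function.update_eq_self m t
        rw [this]; exact v1
      · rw [Function.update_self]; omega
      · rw [Function.update_self, Function.update_of_ne (by omega), Function.update_of_ne (by omega)]
        omega
    · rintro ⟨t, f1, v1⟩
      obtain ⟨v2, p1, p2⟩ := (valid_cons hm.1 hnd'.1).mp v1
      have nn := valid_vec_nonneg (fun p => (ent n lam p : ℤ)) (fun p => by positivity) T hnd'.2 hrT _ v2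
      set u := Function.update t m 0 with hu
      set s0 : Fin n →₀ ℕ := Finsupp.equivFunOnFinite.symm
        (fun p : Fin n => ((ent n lam p.1 : ℤ) + u p.1 - u (p.1 + 1)).toNat) with hs0
      have fl : FlowVec n lam s0 u := by
        intro p
        have : s0 p = ((ent n lam p.1 : ℤ) + u p.1 - u (p.1 + 1)).toNat := rfl
        rw [this, Int.toNat_of_nonneg (nn p.1)]
      have um : u m = 0 := by rw [hu, Function.update_self]
      have une : ∀ x, x ≠ m → u x = t x := fun x hx => by rw [hu, Function.update_of_ne hx]
      have a1 := fl ⟨m, hm.2⟩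
      have a2 := fl ⟨m - 1, hm1⟩
      simp only [hmm] at a1 a2
      rw [um, une (m + 1) (by omega)] at a1
      rw [um, une (m - 1) (by omega)] at a2
      refine ⟨s0, (ih2 s0).mpr ⟨u, fl, v2⟩, (t m).toNat, by omega, ?_⟩
      ext p
      have hp := f1 p
      have hq := fl p
      simp only [Finsupp.coe_add, Finsupp.coe_tsub, Pi.add_apply, Pi.sub_apply,
          Finsupp.single_apply, Fin.ext_iff]
      by_cases c1 : p.1 = m
      · rw [if_neg (by omega), if_pos c1.symm]
        rw [une (p.1 + 1) (by omega), c1, um] at hq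
        rw [c1] at hp
        omega
      · by_cases c2 : p.1 + 1 = m
        · rw [if_pos (by omega), if_neg (by omega)]
          rw [une p.1 (by omega), c2, um] at hq
          rw [c2] at hp
          have b2 := valid_nonneg v1 (m + 1)
          have b3 := nn m
          simp only [um, une (m + 1) (by omega)] at b3
          have e3 : p.1 = m - 1 := by omega
          rw [e3] at hq
          have : p = ⟨m - 1, hm1⟩ := Fin.ext e3
          rw [this] at hp hq ⊢
          simp only at hp hq ⊢
          omega
        · rw [if_neg (by omega), if_neg (by omega)]
          rw [une p.1 c1, une (p.1 + 1) c2] at hq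
          omega

end PartV

end LSS

open scoped Classical

namespace LSS

section PartD

/-- flow upper bound at edge `m` -/
def VB (lam : ℕ → ℤ) (tau : ℕ → ℕ) (t : ℕ → ℤ) (m : ℕ) : Prop :=
  t m ≤ lam (m - 1) - lam m + (if tau m < tau (m - 1) then t (m - 1) else 0) +
    (if tau m < tau (m + 1) then t (m + 1) else 0)

/-- add `D` on the edges `i < m ≤ j` -/
def bmp (i j : ℕ) (D : ℤ) (t : ℕ → ℤ) : ℕ → ℤ := fun m => t m + if i < m ∧ m ≤ j then D else 0

theorem bmp_in {i j : ℕ} {D : ℤ} {t : ℕ → ℤ} {m : ℕ} (h1 : i < m) (h2 : m ≤ j) :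
    bmp i j D t m = t m + D := by
  unfold bmp; rw [if_pos ⟨h1, h2⟩]

theorem bmp_out {i j : ℕ} {D : ℤ} {t : ℕ → ℤ} {m : ℕ} (h : ¬ (i < m ∧ m ≤ j)) :
    bmp i j D t m = t m := by
  unfold bmp; rw [if_neg h, add_zero]

theorem le_bmp {i j : ℕ} {D : ℤ} {t : ℕ → ℤ} (hD : 0 ≤ D) (m : ℕ) : t m ≤ bmp i j D t m := by
  unfold bmp; split_ifs <;> omega

theorem bmp_comm {i j p q : ℕ} {D D' : ℤ} {t : ℕ → ℤ} :
    bmp i j D (bmp p q D' t) = bmp p q D' (bmp i j D t) := by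
  funext m; unfold bmp; ring

theorem vb_same {lam : ℕ → ℤ} {tau : ℕ → ℕ} {s t : ℕ → ℤ} {m : ℕ} (h : VB lam tau s m)
    (hle : ∀ x, s x ≤ t x) (hm : t m ≤ s m) : VB lam tau t m := by
  unfold VB at *
  have h1 := hle (m - 1)
  have h2 := hle (m + 1)
  split_ifs at * <;> omega

theorem vb_right {lam : ℕ → ℤ} {tau : ℕ → ℕ} {s t : ℕ → ℤ} {m : ℕ} (h : VB lam tau s m)
    (hle : ∀ x, s x ≤ t x) (hE : tau m < tau (m + 1)) (hm : t m - s m ≤ t (m + 1) - s (m + 1)) :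
    VB lam tau t m := by
  unfold VB at *
  have h1 := hle (m - 1)
  rw [if_pos hE] at *
  split_ifs at * <;> omega

theorem vb_left {lam : ℕ → ℤ} {tau : ℕ → ℕ} {s t : ℕ → ℤ} {m : ℕ} (h : VB lam tau s m)
    (hle : ∀ x, s x ≤ t x) (hE : tau m < tau (m - 1)) (hm : t m - s m ≤ t (m - 1) - s (m - 1)) :
    VB lam tau t m := by
  unfold VB at *
  have h1 := hle (m + 1)
  rw [if_pos hE] at *
  split_ifs at * <;> omega

theorem valid_iff {lam : ℕ → ℤ} {L : List ℕ} {t : ℕ → ℤ} : Valid lam L t ↔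
    (∀ m, m ∉ L → t m = 0) ∧ ∀ m ∈ L, 0 ≤ t m ∧ VB lam (L.idxOf ·) t m := Iff.rfl

theorem valid_max {lam : ℕ → ℤ} {L : List ℕ} {t1 t2 t : ℕ → ℤ} (h1 : Valid lam L t1)
    (h2 : Valid lam L t2) (ht : ∀ m, t m = max (t1 m) (t2 m)) : Valid lam L t := by
  rw [valid_iff] at *
  refine ⟨fun m hm => by rw [ht, h1.1 m hm, h2.1 m hm, max_self], fun m hm => ⟨?_, ?_⟩⟩
  · rw [ht]; exact le_trans (h1.2 m hm).1 (le_max_left _ _)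
  · rcases le_total (t1 m) (t2 m) with h | h
    · exact vb_same (h2.2 m hm).2 (fun x => by rw [ht]; exact le_max_right _ _)
        (by rw [ht, max_eq_right h])
    · exact vb_same (h1.2 m hm).2 (fun x => by rw [ht]; exact le_max_left _ _)
        (by rw [ht, max_eq_left h])

theorem down_prop {tau : ℕ → ℕ} {i R v : ℕ} (hv : v ≤ R)
    (hinj : ∀ e, i < e → e + 1 ≤ R → tau e ≠ tau (e + 1))
    (hns : ∀ e, i < e → e ≤ R → ¬ (tau e < tau (e - 1) ∧ tau e < tau (e + 1)))
    (h0 : ¬ tau v < tau (v - 1)) (g : ℕ) : ∀ e, e + g = v → i < e →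
      ¬ tau e < tau (e - 1) ∧ (e < v → tau e < tau (e + 1)) := by
  induction g with
  | zero => intro e he hie; obtain rfl : e = v := by omega
            exact ⟨h0, fun h => absurd h (lt_irrefl _)⟩
  | succ g ih =>
    intro e he hie
    have h1 := (ih (e + 1) (by omega) (by omega)).1
    rw [Nat.add_sub_cancel] at h1
    have h2 := hinj e hie (by omega)
    have h3 : tau e < tau (e + 1) := by omega
    have h4 := hns e hie (by omega)
    exact ⟨fun h => h4 ⟨h, h3⟩, fun _ => h3⟩

theorem up_prop {tau : ℕ → ℕ} {i R v : ℕ} (hv : i < v)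
    (hinj : ∀ e, i < e → e + 1 ≤ R → tau e ≠ tau (e + 1))
    (hns : ∀ e, i < e → e ≤ R → ¬ (tau e < tau (e - 1) ∧ tau e < tau (e + 1)))
    (h0 : ¬ tau v < tau (v + 1)) (g : ℕ) : v + g ≤ R →
      ¬ tau (v + g) < tau (v + g + 1) ∧ (0 < g → tau (v + g) < tau (v + g - 1)) := by
  induction g with
  | zero => intro _; exact ⟨h0, fun h => absurd h (lt_irrefl _)⟩
  | succ g ih =>
    intro hR
    have h1 := (ih (by omega)).1
    have h2 := hinj (v + g) (by omega) (by omega)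
    have e : v + (g + 1) = v + g + 1 := rfl
    rw [e, Nat.add_sub_cancel]
    have h3 : tau (v + g + 1) < tau (v + g) := by omega
    have h4 := hns (v + g + 1) (by omega) (by omega)
    rw [Nat.add_sub_cancel] at h4
    exact ⟨fun h => h4 ⟨h3, h⟩, fun _ => h3⟩

theorem valley_contra {lam : ℕ → ℤ} (hlam : Antitone lam) {tau : ℕ → ℕ} {t : ℕ → ℤ}
    (ht : ∀ m, 0 ≤ t m) {i j p q v R : ℕ} (hip : i < p) (hpv : p < v) (hvj : v ≤ j) (hvq : v ≤ q)
    (hjq : j ≠ q) (hjR : j ≤ R) (hqR : q ≤ R)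
    (hinj : ∀ e, i < e → e + 1 ≤ R → tau e ≠ tau (e + 1))
    (hns : ∀ e, i < e → e ≤ R → ¬ (tau e < tau (e - 1) ∧ tau e < tau (e + 1)))
    (hvb : ∀ e, i < e → e ≤ R → VB lam tau t e)
    (h1 : ¬ tau v < tau (v - 1)) (h2 : ¬ tau v < tau (v + 1)) (D1 D2 : ℤ)
    (hD1 : D1 = (lam i + t i - t (i + 1)) - (lam j + t j - t (j + 1)) + ((j : ℤ) - i))
    (hD2 : D2 = (lam p + t p - t (p + 1)) - (lam q + t q - t (q + 1)) + ((q : ℤ) - p))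
    (hV1 : VB lam tau (bmp i j D1 t) v) (hV2 : VB lam tau (bmp p q D2 t) v) : False := by
  have hdown := down_prop (v := v) (by omega) hinj hns h1
  have hup := up_prop (v := v) (by omega) hinj hns h2
  -- left monotonicity
  have hf : ∀ g e, e + g ≤ v → i < e →
      lam (e + g - 1) - t (e + g) ≤ lam (e - 1) - t e := by
    intro g
    induction g with
    | zero => intro e _ _; simp
    | succ g ih =>
      intro e he hie
      have a1 := ih e (by omega) hie
      have a2 := hdown (v - (e + g)) (e + g) (by omega) (by omega)
      have a3 := hvb (e + g) (by omega) (by omega)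
      unfold VB at a3
      rw [if_neg a2.1, if_pos (a2.2 (by omega))] at a3
      have e1 : e + (g + 1) - 1 = e + g := by omega
      have e2 : e + (g + 1) = e + g + 1 := rfl
      rw [e1, e2]
      linarith
  have hg : ∀ g e, v ≤ e → e + g ≤ R → lam (e + g) + t (e + g) ≤ lam e + t e := by
    intro g
    induction g with
    | zero => intro e _ _; simp
    | succ g ih =>
      intro e he hie
      have a1 := ih e he (by omega)
      have a2 := hup (e + g + 1 - v) (by omega)
      have e3 : v + (e + g + 1 - v) = e + g + 1 := by omega
      rw [e3] at a2
      have a3 := hvb (e + g + 1) (by omega) (by omega)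
      unfold VB at a3
      rw [if_neg a2.1, if_pos (a2.2 (by omega)), Nat.add_sub_cancel] at a3
      have e2 : e + (g + 1) = e + g + 1 := rfl
      rw [e2]
      linarith
  unfold VB at hV1 hV2
  rw [if_neg h1, if_neg h2, bmp_in (by omega) (by omega)] at hV1 hV2
  have f1 := hf (p - (i + 1)) (i + 1) (by omega) (by omega)
  rw [show i + 1 + (p - (i + 1)) = p by omega, Nat.add_sub_cancel] at f1
  have f2 := hf (v - (p + 1)) (p + 1) (by omega) (by omega)
  rw [show p + 1 + (v - (p + 1)) = v by omega, Nat.add_sub_cancel] at f2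
  have l1 : lam (v - 1) ≤ lam (p - 1) := hlam (by omega)
  have n1 := ht i
  have n2 := ht (j + 1)
  have n3 := ht (q + 1)
  rcases Nat.lt_or_gt_of_ne hjq with hlt | hlt
  · have g1 := hg (j - v) v le_rfl (by omega)
    rw [show v + (j - v) = j by omega] at g1
    have g2 := hg (q - (j + 1)) (j + 1) (by omega) (by omega)
    rw [show j + 1 + (q - (j + 1)) = q by omega] at g2
    have l2 : lam (j + 1) ≤ lam v := hlam (by omega)
    omega
  · have g1 := hg (q - v) v le_rfl (by omega)
    rw [show v + (q - v) = q by omega] at g1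
    have g2 := hg (j - (q + 1)) (q + 1) (by omega) (by omega)
    rw [show q + 1 + (j - (q + 1)) = j by omega] at g2
    have l2 : lam (q + 1) ≤ lam v := hlam (by omega)
    omega

/-- edges moved by a positive bump lie in the support of the word -/
theorem mem_of_bmp {lam : ℕ → ℤ} {L : List ℕ} {t : ℕ → ℤ} {i j : ℕ} {D : ℤ} (hD : 0 < D)
    (h : Valid lam L t) (h1 : Valid lam L (bmp i j D t)) {m : ℕ} (hi : i < m) (hj : m ≤ j) :
    m ∈ L := by
  by_contra hm
  have a := h1.1 m hm
  rw [bmp_in hi hj, h.1 m hm] at a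
  omega

theorem idx_inj {L : List ℕ} {x y : ℕ} (hx : x ∈ L) (hxy : x ≠ y) : L.idxOf x ≠ L.idxOf y := by
  intro h
  exact hxy ((List.idxOf_inj hx).mp h)

theorem valid_distinct {lam : ℕ → ℤ} (hlam : Antitone lam) {L : List ℕ} {t : ℕ → ℤ}
    {i j p q : ℕ} {D1 D2 : ℤ} (hip : i < p) (hjq : j ≠ q) (hp1 : 0 < D1) (hp2 : 0 < D2)
    (hns : ∀ e, ((i < e ∧ e ≤ j) ∨ (p < e ∧ e ≤ q)) → e ∈ L →
      ¬ (L.idxOf e < L.idxOf (e - 1) ∧ L.idxOf e < L.idxOf (e + 1)))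
    (hD1 : D1 = (lam i + t i - t (i + 1)) - (lam j + t j - t (j + 1)) + ((j : ℤ) - i))
    (hD2 : D2 = (lam p + t p - t (p + 1)) - (lam q + t q - t (q + 1)) + ((q : ℤ) - p))
    (h : Valid lam L t) (h1 : Valid lam L (bmp i j D1 t)) (h2 : Valid lam L (bmp p q D2 t)) :
    Valid lam L (bmp p q D2 (bmp i j D1 t)) := by
  have memA : ∀ m, i < m → m ≤ j → m ∈ L := fun m => mem_of_bmp hp1 h h1
  have memB : ∀ m, p < m → m ≤ q → m ∈ L := fun m => mem_of_bmp hp2 h h2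
  have hv := h; have hv1 := h1; have hv2 := h2
  rw [valid_iff] at h h1 h2 ⊢
  have le1 : ∀ m, bmp i j D1 t m ≤ bmp p q D2 (bmp i j D1 t) m := le_bmp hp2.le
  have le2 : ∀ m, bmp p q D2 t m ≤ bmp p q D2 (bmp i j D1 t) m := by
    intro m; rw [bmp_comm]; exact le_bmp hp1.le m
  have le0 : ∀ m, t m ≤ bmp p q D2 (bmp i j D1 t) m := fun m => (le_bmp hp1.le m).trans (le1 m)
  refine ⟨?_, fun m hm => ⟨(h.2 m hm).1.trans (le0 m), ?_⟩⟩
  · intro m hm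
    rw [bmp_out (fun hh => hm (memB m hh.1 hh.2)), bmp_out (fun hh => hm (memA m hh.1 hh.2))]
    exact h.1 m hm
  · by_cases hB : p < m ∧ m ≤ q
    swap
    · exact vb_same (h1.2 m hm).2 le1 (by rw [bmp_out hB])
    by_cases hA : i < m ∧ m ≤ j
    swap
    · refine vb_same (h2.2 m hm).2 le2 ?_
      rw [bmp_comm, bmp_out hA]
    by_cases E1 : L.idxOf m < L.idxOf (m + 1)
    · by_cases cA : m + 1 ≤ j
      · by_cases cB : m + 1 ≤ q
        · refine vb_right (h.2 m hm).2 le0 E1 ?_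
          simp only [bmp]
          rw [if_pos hA, if_pos hB, if_pos (by omega), if_pos (by omega)]
          omega
        · refine vb_right (h2.2 m hm).2 le2 E1 ?_
          simp only [bmp]
          rw [if_pos hA, if_pos hB, if_pos (by omega), if_neg (by omega)]
          omega
      · have cB : m + 1 ≤ q := by omega
        refine vb_right (h1.2 m hm).2 le1 E1 ?_
        simp only [bmp]
        rw [if_pos hA, if_pos hB, if_neg (by omega), if_pos (by omega)]
        omega
    by_cases E2 : L.idxOf m < L.idxOf (m - 1)
    · by_cases cA : i < m - 1
      · by_cases cB : p < m - 1
        · refine vb_left (h.2 m hm).2 le0 E2 ?_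
          simp only [bmp]
          rw [if_pos hA, if_pos hB, if_pos (by omega), if_pos (by omega)]
          omega
        · refine vb_left (h2.2 m hm).2 le2 E2 ?_
          simp only [bmp]
          rw [if_pos hA, if_pos hB, if_pos (by omega), if_neg (by omega)]
          omega
      · omega
    exfalso
    have memU : ∀ e, i < e → e ≤ max j q → e ∈ L := by
      intro e h1 h2
      by_cases c : e ≤ j
      · exact memA e h1 c
      · exact memB e (by omega) (by omega)
    refine valley_contra hlam (tau := (L.idxOf ·)) (valid_nonneg hv) (R := max j q) hip hB.1 hA.2
      hB.2 hjq (le_max_left _ _) (le_max_right _ _) ?_ ?_ ?_ E2 E1 D1 D2 hD1 hD2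
      (h1.2 m hm).2 (h2.2 m hm).2
    · intro e he1 he2
      exact idx_inj (memU e he1 (by omega)) (by omega)
    · intro e he1 he2
      refine hns e ?_ (memU e he1 he2)
      by_cases c : e ≤ j
      · exact Or.inl ⟨he1, c⟩
      · exact Or.inr ⟨by omega, by omega⟩
    · intro e he1 he2
      exact (h.2 e (memU e he1 he2)).2

theorem valid_chain {lam : ℕ → ℤ} {L : List ℕ} {t : ℕ → ℤ}
    {i j q : ℕ} {D1 D2 : ℤ} (hij : i < j) (hjq : j < q) (hp1 : 0 < D1) (hp2 : 0 < D2)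
    (hns : ∀ e, i < e → e ≤ q → e ∈ L →
      ¬ (L.idxOf e < L.idxOf (e - 1) ∧ L.idxOf e < L.idxOf (e + 1)))
    (h : Valid lam L t) (h1 : Valid lam L (bmp i j D1 t)) (h2 : Valid lam L (bmp j q D2 t)) :
    Valid lam L (bmp i q D2 (bmp i j D1 t)) ∨ Valid lam L (bmp i q D1 (bmp j q D2 t)) := by
  have memU : ∀ m, i < m → m ≤ q → m ∈ L := by
    intro m a1 a2
    by_cases c : m ≤ j
    · exact mem_of_bmp hp1 h h1 a1 c
    · exact mem_of_bmp hp2 h h2 (by omega) a2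
  have hinj : ∀ e, i < e → e + 1 ≤ q → L.idxOf e ≠ L.idxOf (e + 1) := fun e a1 a2 =>
    idx_inj (memU e a1 (by omega)) (by omega)
  have hv1 := h1; have hv2 := h2
  rw [valid_iff] at h1 h2
  by_cases hall : ∀ m, i < m → m ≤ j → L.idxOf m < L.idxOf (m + 1)
  · left
    rw [valid_iff]
    have le1 : ∀ m, bmp i j D1 t m ≤ bmp i q D2 (bmp i j D1 t) m := le_bmp hp2.le
    refine ⟨?_, fun m hm => ⟨(h1.2 m hm).1.trans (le1 m), ?_⟩⟩
    · intro m hm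
      rw [bmp_out (fun hh => hm (memU m hh.1 hh.2)),
        bmp_out (fun hh => hm (memU m hh.1 (by omega)))]
      exact h.1 m hm
    · by_cases cU : i < m ∧ m ≤ q
      swap
      · exact vb_same (h1.2 m hm).2 le1 (by rw [bmp_out cU])
      by_cases cA : m ≤ j
      · refine vb_right (h1.2 m hm).2 le1 (hall m cU.1 cA) ?_
        rw [bmp_in cU.1 cU.2, bmp_in (i := i) (j := q) (m := m + 1) (by omega) (by omega)]
        omega
      · refine vb_same (h2.2 m hm).2 ?_ ?_
        · intro x
          simp only [bmp]
          split_ifs <;> omega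
        · simp only [bmp]
          rw [if_pos cU, if_neg (by omega), if_pos (by omega)]
          omega
  · right
    push Not at hall
    obtain ⟨m0, hm1, hm2, hm3⟩ := hall
    have hup := up_prop (tau := (L.idxOf ·)) (i := i) (R := q) (v := m0) hm1 hinj
      (fun e a1 a2 => hns e a1 a2 (memU e a1 a2)) (by omega)
    rw [valid_iff]
    have le1 : ∀ m, bmp j q D2 t m ≤ bmp i q D1 (bmp j q D2 t) m := le_bmp hp1.le
    refine ⟨?_, fun m hm => ⟨(h2.2 m hm).1.trans (le1 m), ?_⟩⟩
    · intro m hm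
      rw [bmp_out (fun hh => hm (memU m hh.1 hh.2)),
        bmp_out (fun hh => hm (memU m (by omega) hh.2))]
      exact h.1 m hm
    · by_cases cU : i < m ∧ m ≤ q
      swap
      · exact vb_same (h2.2 m hm).2 le1 (by rw [bmp_out cU])
      by_cases cA : j < m
      · have hE := (hup (m - m0) (by omega)).2 (by omega)
        rw [show m0 + (m - m0) = m by omega] at hE
        refine vb_left (h2.2 m hm).2 le1 hE ?_
        rw [bmp_in cU.1 cU.2, bmp_in (i := i) (j := q) (m := m - 1) (by omega) (by omega)]
        omega
      · refine vb_same (h1.2 m hm).2 ?_ ?_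
        · intro x
          simp only [bmp]
          split_ifs <;> omega
        · simp only [bmp]
          split_ifs <;> omega

end PartD

end LSS

open scoped Classical

namespace LSS

section PartB

theorem sb_symm {n k : ℕ} {d : Fin (k + 2) → ℕ} {i j : Fin n} (h : SameBlock n k d i j) :
    SameBlock n k d j i := by
  obtain ⟨t, h1, h2, h3, h4⟩ := h
  exact ⟨t, h3, h4, h1, h2⟩

theorem sb_trans {n k : ℕ} {d : Fin (k + 2) → ℕ} (hd : BlockData n k d) {a b c : Fin n}
    (h1 : SameBlock n k d a b) (h2 : SameBlock n k d b c) : SameBlock n k d a c := by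
  obtain ⟨t, a1, a2, a3, a4⟩ := h1
  obtain ⟨s, b1, b2, b3, b4⟩ := h2
  have hm := hd.2.2
  have e1 : t.castSucc < s.succ := hm.lt_iff_lt.mp (by omega)
  have e2 : s.castSucc < t.succ := hm.lt_iff_lt.mp (by omega)
  have : t = s := by
    rw [Fin.lt_def] at e1 e2
    simp at e1 e2
    apply Fin.ext; omega
  subst this
  exact ⟨t, a1, a2, b3, b4⟩

theorem sb_mid {n k : ℕ} {d : Fin (k + 2) → ℕ} {i m j : Fin n}
    (h : SameBlock n k d i j) (h1 : i ≤ m) (h2 : m ≤ j) : SameBlock n k d i m := by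
  obtain ⟨t, a1, a2, a3, a4⟩ := h
  rw [Fin.le_def] at h1 h2
  exact ⟨t, a1, a2, by omega, by omega⟩

theorem sb_edge {n k : ℕ} {d : Fin (k + 2) → ℕ} (hd : BlockData n k d) {i j : Fin n}
    (h : SameBlock n k d i j) {e : ℕ} (h1 : i.1 < e) (h2 : e ≤ j.1) : e ∈ Iset n k d := by
  obtain ⟨t, a1, a2, a3, a4⟩ := h
  have hj := j.2
  refine ⟨by omega, by omega, ?_⟩
  rintro ⟨s, _, _, hs⟩
  have e1 : t.castSucc < s := hd.2.2.lt_iff_lt.mp (by omega)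
  have e2 : s < t.succ := hd.2.2.lt_iff_lt.mp (by omega)
  rw [Fin.lt_def] at e1 e2
  simp at e1 e2
  omega

theorem gap_iff {n : ℕ} (β : Fin n → ℤ) (a b : Fin n) :
    β a < β b - gapZ n a b ↔ β a - (a.1 : ℤ) < β b - (b.1 : ℤ) := by
  unfold gapZ; omega

theorem tmv_val {n : ℕ} {i j : Fin n} (β : Fin n → ℤ) (a : Fin n) :
    tmv n i j β a - (a.1 : ℤ) = β (Equiv.swap i j a) - ((Equiv.swap i j a).1 : ℤ) := by
  unfold tmv gapZ
  rw [Equiv.swap_apply_def]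
  by_cases c1 : a = i
  · subst c1; rw [if_pos rfl, if_pos rfl]; omega
  · by_cases c2 : a = j
    · subst c2; rw [if_neg c1, if_pos rfl, if_neg c1, if_pos rfl]; omega
    · simp [c1, c2]

theorem swap_rev {n : ℕ} {i j a b : Fin n} (hij : i < j) (hab : a < b)
    (h : ¬ Equiv.swap i j a < Equiv.swap i j b) :
    (a = i ∧ b = j) ∨ (a = i ∧ b ≠ j ∧ b ≠ i) ∨ (b = j ∧ a ≠ i ∧ a ≠ j) := by
  rw [Equiv.swap_apply_def, Equiv.swap_apply_def] at h
  simp only [Fin.lt_def, Fin.ext_iff] at *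
  split_ifs at h <;> omega

theorem theta_two {n k : ℕ} {d : Fin (k + 2) → ℕ} (hd : BlockData n k d) {i m j : Fin n}
    (him : i < m) (hmj : m < j) (hsb : SameBlock n k d i j) (β : Fin n → ℤ)
    (h0 : β j - (j.1 : ℤ) < β i - (i.1 : ℤ)) (h1 : β j - (j.1 : ℤ) ≤ β m - (m.1 : ℤ))
    (h2 : β m - (m.1 : ℤ) ≤ β i - (i.1 : ℤ)) :
    theta n k d β + 2 ≤ theta n k d (tmv n i j β) := by
  have hij : i < j := him.trans hmj
  set σ := Equiv.swap i j with hσ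
  set v : Fin n → ℤ := fun a => β a - (a.1 : ℤ) with hv
  have hσσ : ∀ x, σ (σ x) = x := fun x => Equiv.swap_apply_self i j x
  have σi : σ i = j := Equiv.swap_apply_left i j
  have σj : σ j = i := Equiv.swap_apply_right i j
  have σne : ∀ x, x ≠ i → x ≠ j → σ x = x := fun x a b => Equiv.swap_apply_of_ne_of_ne a b
  set A := Finset.univ.filter fun p : Fin n × Fin n =>
    p.1 < p.2 ∧ SameBlock n k d p.1 p.2 ∧ β p.1 < β p.2 - gapZ n p.1 p.2 with hA
  set B := Finset.univ.filter fun p : Fin n × Fin n =>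
    p.1 < p.2 ∧ SameBlock n k d p.1 p.2 ∧ tmv n i j β p.1 < tmv n i j β p.2 - gapZ n p.1 p.2
    with hB
  have memA : ∀ a b, (a, b) ∈ A ↔ a < b ∧ SameBlock n k d a b ∧ v a < v b := by
    intro a b
    rw [hA, Finset.mem_filter]
    simp only [Finset.mem_univ, true_and, gap_iff, hv]
  have memB : ∀ a b, (a, b) ∈ B ↔ a < b ∧ SameBlock n k d a b ∧ v (σ a) < v (σ b) := by
    intro a b
    rw [hB, Finset.mem_filter]
    simp only [Finset.mem_univ, true_and, gap_iff, hv, tmv_val, hσ]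
  have h0' : v j < v i := h0
  have h1' : v j ≤ v m := h1
  have h2' : v m ≤ v i := h2
  have sbσ : ∀ a b, SameBlock n k d a b → SameBlock n k d a (σ a) := by
    intro a b h
    by_cases c1 : a = i
    · rw [c1, σi]; exact hsb
    · by_cases c2 : a = j
      · rw [c2, σj]; exact sb_symm hsb
      · rw [σne a c1 c2]; exact sb_trans hd h (sb_symm h)
  set φ : Fin n × Fin n → Fin n × Fin n := fun x =>
    if σ x.1 < σ x.2 then (σ x.1, σ x.2) else x with hφ
  have mi : m ≠ i := him.ne'
  have mj : m ≠ j := hmj.ne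
  -- image lies in B
  have himg : ∀ x ∈ A, φ x ∈ B := by
    rintro ⟨a, b⟩ hx
    obtain ⟨x1, x2, x3⟩ := (memA a b).mp hx
    simp only [hφ]
    split_ifs with hc
    · rw [memB]
      refine ⟨hc, ?_, by rw [hσσ, hσσ]; exact x3⟩
      exact sb_trans hd (sb_symm (sbσ a b x2)) (sb_trans hd x2 (sbσ b a (sb_symm x2)))
    · rw [memB]
      refine ⟨x1, x2, ?_⟩
      rcases swap_rev hij x1 hc with ⟨e1, e2⟩ | ⟨e1, e2, e3⟩ | ⟨e1, e2, e3⟩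
      · subst e1 e2; omega
      · rw [σne b e3 e2, e1, σi]; rw [e1] at x3; omega
      · rw [σne a e2 e3, e1, σj]; rw [e1] at x3; omega
  have hinj : Set.InjOn φ A := by
    rintro ⟨a, b⟩ hx ⟨a', b'⟩ hy hxy
    obtain ⟨x1, _, _⟩ := (memA a b).mp hx
    obtain ⟨y1, _, _⟩ := (memA a' b').mp hy
    simp only [hφ] at hxy
    split_ifs at hxy with c1 c2 c2
    · obtain ⟨e1, e2⟩ := Prod.mk.inj hxy
      rw [σ.injective e1, σ.injective e2]
    · obtain ⟨e1, e2⟩ := Prod.mk.inj hxy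
      exfalso; apply c2; rw [← e1, ← e2, hσσ, hσσ]; exact x1
    · obtain ⟨e1, e2⟩ := Prod.mk.inj hxy
      exfalso; apply c1; rw [e1, e2, hσσ, hσσ]; exact y1
    · exact hxy
  have avoid : ∀ a b, ¬ (σ a < σ b) → ¬ (v a < v b) → (a, b) ∉ A.image φ := by
    intro a b hs hvab hmem
    obtain ⟨⟨a', b'⟩, hx, hxy⟩ := Finset.mem_image.mp hmem
    obtain ⟨x1, _, x3⟩ := (memA a' b').mp hx
    simp only [hφ] at hxy
    split_ifs at hxy with c1
    · obtain ⟨e1, e2⟩ := Prod.mk.inj hxy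
      apply hs; rw [← e1, ← e2, hσσ, hσσ]; exact x1
    · obtain ⟨e1, e2⟩ := Prod.mk.inj hxy
      apply hvab; rw [← e1, ← e2]; exact x3
  have fin : ∀ a b, (a, b) ≠ (i, j) → a < b → SameBlock n k d a b → v (σ a) < v (σ b) →
      ¬ (σ a < σ b) → ¬ (v a < v b) → A.card + 2 ≤ B.card := by
    intro a b hne hab hs hvv c1 c2
    have n1 := avoid a b c1 c2
    have n2 := avoid i j (by rw [σi, σj]; exact not_lt.mpr hij.le) (by omega)
    have hsub : insert (a, b) (insert (i, j) (A.image φ)) ⊆ B := by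
      intro x hx
      rcases Finset.mem_insert.mp hx with rfl | hx
      · exact (memB a b).mpr ⟨hab, hs, hvv⟩
      · rcases Finset.mem_insert.mp hx with rfl | hx
        · exact (memB i j).mpr ⟨hij, hsb, by rw [σi, σj]; exact h0'⟩
        · obtain ⟨y, hy, rfl⟩ := Finset.mem_image.mp hx
          exact himg y hy
    have hc := Finset.card_le_card hsub
    rw [Finset.card_insert_of_notMem (by
      rw [Finset.mem_insert]; rintro (h | h)
      · exact hne h
      · exact n1 h), Finset.card_insert_of_notMem n2, Finset.card_image_of_injOn hinj] at hc
    omega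
  show A.card + 2 ≤ B.card
  have sim : SameBlock n k d i m := sb_mid hsb him.le hmj.le
  by_cases hc : v j < v m
  · refine fin i m (fun h => mj (Prod.mk.inj h).2) him sim ?_ ?_ (by omega)
    · rw [σi, σne m mi mj]; exact hc
    · rw [σi, σne m mi mj]; exact not_lt.mpr hmj.le
  · refine fin m j (fun h => mi (Prod.mk.inj h).1) hmj (sb_trans hd (sb_symm sim) hsb) ?_ ?_ (by omega)
    · rw [σj, σne m mi mj]; omega
    · rw [σj, σne m mi mj]; exact not_lt.mpr him.le

theorem cover_mid {n k : ℕ} {d : Fin (k + 2) → ℕ} (hd : BlockData n k d) {i m j : Fin n}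
    (him : i < m) (hmj : m < j) (hsb : SameBlock n k d i j) (β : Fin n → ℤ)
    (hcov : β j - gapZ n i j < β i ∧ theta n k d (tmv n i j β) = theta n k d β + 1) :
    ¬ (β j - (j.1 : ℤ) ≤ β m - (m.1 : ℤ) ∧ β m - (m.1 : ℤ) ≤ β i - (i.1 : ℤ)) := by
  rintro ⟨h1, h2⟩
  have h0 : β j - (j.1 : ℤ) < β i - (i.1 : ℤ) := by
    have := hcov.1; unfold gapZ at this; omega
  have := theta_two hd him hmj hsb β h0 h1 h2
  omega

end PartB

end LSS

open scoped Classical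

namespace LSS

section PartF
open MvPolynomial

theorem key_flow {n k : ℕ} {d : Fin (k + 2) → ℕ}
    {c w0I : Equiv.Perm (Fin n)} (hc : IsStdCox n c)
    (h0 : IsLongest n (Iset n k d) w0I)
    (hlen : len n (w0I * c) = len n w0I + len n c)
    (lam : Fin n → ℕ) (hlam : IsPartition n lam) :
    ∃ L : List ℕ, L.Nodup ∧ (∀ m ∈ L, 1 ≤ m ∧ m < n) ∧
      (∀ m ∈ L, m ∈ Iset n k d →
        ¬ (L.idxOf m < L.idxOf (m - 1) ∧ L.idxOf m < L.idxOf (m + 1))) ∧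
      ∀ s, coeff s (keyPoly n (pact n c lam)) ≠ 0 ↔
        ∃ t, FlowVec n lam s t ∧ Valid (fun p => (ent n lam p : ℤ)) L t := by
  obtain ⟨L0, hnd, hr, rfl⟩ := hc
  have hl : L0.length ≤ n * n := by
    have h1 : L0.toFinset ⊆ Finset.range n := by
      intro x hx
      have := hr x (List.mem_toFinset.mp hx)
      rw [Finset.mem_range]; omega
    have h2 := Finset.card_le_card h1
    rw [List.toFinset_card_of_nodup hnd, Finset.card_range] at h2
    exact h2.trans (Nat.le_mul_self n)
  obtain ⟨L, _, hKW, hkey⟩ := key_word lam hlam (n * n) L0 hnd hr hl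
  obtain ⟨k1, k2⟩ := KW_nodup hKW
  refine ⟨L, k1, k2, ?_, ?_⟩
  · rintro m hm hmI ⟨e1, e2⟩
    have hmr := k2 m hm
    have := KW_sink hKW m hm (by
      intro m' _ hc
      rcases hc with rfl | rfl
      · exact e2
      · exact e1)
    apply longest_no_des h0 hlen hmI
    refine ⟨⟨by omega, hmr.2⟩, ?_⟩
    by_contra hcon
    have h3 := hlam _ _ (not_lt.mp hcon)
    rw [ent_lt _ hmr.2, ent_lt _ (show m - 1 < n by omega)] at this
    exact absurd this (not_lt.mpr h3)
  · unfold keyPoly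
    rw [hkey]
    exact (word_support lam hlam L k1 k2).2

/-- integer version of `FlowVec` -/
def BFlow (n : ℕ) (lam : Fin n → ℕ) (β : Fin n → ℤ) (t : ℕ → ℤ) : Prop :=
  ∀ p : Fin n, β p = (ent n lam p.1 : ℤ) + t p.1 - t (p.1 + 1)

theorem flow_tmv {n : ℕ} {lam : Fin n → ℕ} {β : Fin n → ℤ} {t : ℕ → ℤ} (h : BFlow n lam β t)
    {i j : Fin n} (hij : i < j) {D : ℤ} (hD : D = (β i - (i.1 : ℤ)) - (β j - (j.1 : ℤ))) :
    BFlow n lam (tmv n i j β) (bmp i.1 j.1 D t) := by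
  intro p
  have hp := h p
  rw [Fin.lt_def] at hij
  unfold tmv gapZ bmp
  by_cases c1 : p = i
  · subst c1
    rw [if_pos rfl, if_neg (by omega), if_pos (by omega)]
    omega
  · by_cases c2 : p = j
    · subst c2
      rw [if_neg c1, if_pos rfl, if_pos (by omega), if_neg (by omega)]
      omega
    · rw [if_neg c1, if_neg c2]
      rw [Fin.ext_iff] at c1 c2
      split_ifs <;> omega

theorem flow_uniq {n : ℕ} {lam : Fin n → ℕ} {L : List ℕ} (hr : ∀ m ∈ L, 1 ≤ m ∧ m < n)
    {l : ℕ → ℤ} {β : Fin n → ℤ} {t t' : ℕ → ℤ} (h : BFlow n lam β t) (h' : BFlow n lam β t')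
    (h0 : t' 0 = 0) (hn : ∀ m, n < m → t' m = 0) (hv : Valid l L t) : t = t' := by
  funext m
  by_cases hm : n < m
  · rw [hn m hm, hv.1 m (fun hh => by have := hr m hh; omega)]
  · push Not at hm
    induction m with
    | zero => rw [h0, hv.1 0 (fun hh => by have := hr 0 hh; omega)]
    | succ m ih =>
      have e := ih (by omega)
      have a1 := h ⟨m, by omega⟩
      have a2 := h' ⟨m, by omega⟩
      simp only at a1 a2
      omega

theorem memP_flow {n k : ℕ} {d : Fin (k + 2) → ℕ} {w0I : Equiv.Perm (Fin n)}
    {α lam : Fin n → ℕ} {γ : Fin (k + 1) → ℕ → ℕ} {L : List ℕ}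
    (hsup : ∀ s, coeff s (keyPoly n α) ≠ 0 ↔
        ∃ t, FlowVec n lam s t ∧ Valid (fun p => (ent n lam p : ℤ)) L t)
    {β : Fin n → ℤ} (h : memP n k d w0I α γ β) :
    ∃ t, BFlow n lam β t ∧ Valid (fun p => (ent n lam p : ℤ)) L t := by
  obtain ⟨t, h1, h2⟩ := (hsup _).mp h.2.1
  refine ⟨t, ?_, h2⟩
  intro p
  rw [← h1 p]
  have := h.1 p
  show β p = (((β p).toNat : ℕ) : ℤ)
  omega

theorem memP_up {n k : ℕ} {d : Fin (k + 2) → ℕ} (hd : BlockData n k d)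
    {w0I : Equiv.Perm (Fin n)} (h0 : IsLongest n (Iset n k d) w0I)
    {α lam : Fin n → ℕ} {γ : Fin (k + 1) → ℕ → ℕ} {L : List ℕ} (hnd : L.Nodup)
    (hr : ∀ m ∈ L, 1 ≤ m ∧ m < n)
    (hsup : ∀ s, coeff s (keyPoly n α) ≠ 0 ↔
        ∃ t, FlowVec n lam s t ∧ Valid (fun p => (ent n lam p : ℤ)) L t)
    {β : Fin n → ℤ} (h : memP n k d w0I α γ β) {i j : Fin n} (hij : i < j)
    (hsb : SameBlock n k d i j) {t : ℕ → ℤ} (hf : BFlow n lam (tmv n i j β) t)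
    (hv : Valid (fun p => (ent n lam p : ℤ)) L t) : memP n k d w0I α γ (tmv n i j β) := by
  have hnn : ∀ p, 0 ≤ tmv n i j β p := by
    intro p
    rw [hf p]
    exact valid_vec_nonneg (fun p => (ent n lam p : ℤ)) (fun p => by positivity) L hnd hr t hv p.1
  obtain ⟨b1, b2, W, hW, b3⟩ := h
  refine ⟨hnn, ?_, W, hW, ?_⟩
  · apply (hsup _).mpr
    refine ⟨t, ?_, hv⟩
    intro p
    rw [← hf p]
    show (((tmv n i j β p).toNat : ℕ) : ℤ) = _
    have := hnn p
    omega
  · rw [word_tmv h0 hW hij (fun m => sb_edge hd hsb) β b1 hnn]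
    rcases b3 with e | e
    · right; rw [e]
    · left; rw [e, neg_neg]

theorem tmv_eq {n : ℕ} {a b c e i j p q : Fin n} (β : Fin n → ℤ)
    (h : Equiv.swap i j * Equiv.swap a b = Equiv.swap p q * Equiv.swap c e) :
    tmv n a b (tmv n i j β) = tmv n c e (tmv n p q β) := by
  funext x
  have h1 := tmv_val (i := a) (j := b) (tmv n i j β) x
  have h2 := tmv_val (i := c) (j := e) (tmv n p q β) x
  have h1' := tmv_val (i := i) (j := j) β (Equiv.swap a b x)
  have h2' := tmv_val (i := p) (j := q) β (Equiv.swap c e x)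
  have h3 := congrArg (fun f : Equiv.Perm (Fin n) => f x) h
  simp only [Equiv.Perm.mul_apply] at h3
  rw [h3] at h1'
  omega

theorem finish {n k : ℕ} {d : Fin (k + 2) → ℕ} (hd : BlockData n k d)
    {w0I : Equiv.Perm (Fin n)} (h0 : IsLongest n (Iset n k d) w0I)
    {α lam : Fin n → ℕ} {γ : Fin (k + 1) → ℕ → ℕ} {L : List ℕ} (hnd : L.Nodup)
    (hr : ∀ m ∈ L, 1 ≤ m ∧ m < n)
    (hsup : ∀ s, coeff s (keyPoly n α) ≠ 0 ↔
        ∃ t, FlowVec n lam s t ∧ Valid (fun p => (ent n lam p : ℤ)) L t)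
    {β : Fin n → ℤ} {i j p q : Fin n} (h : memP n k d w0I α γ (tmv n i j β)) (hij : i < j)
    {t : ℕ → ℤ} (hf : BFlow n lam β t) (a b c e : Fin n) (hab : a < b) (hce : c < e)
    (sab : SameBlock n k d a b) (sce : SameBlock n k d c e) {D1 D' : ℤ}
    (hD1 : D1 = (β i - (i.1 : ℤ)) - (β j - (j.1 : ℤ)))
    (hD' : D' = (β (Equiv.swap i j a) - ((Equiv.swap i j a).1 : ℤ)) -
      (β (Equiv.swap i j b) - ((Equiv.swap i j b).1 : ℤ))) (hpos : 0 < D')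
    (h2 : β (Equiv.swap p q e) - ((Equiv.swap p q e).1 : ℤ) <
      β (Equiv.swap p q c) - ((Equiv.swap p q c).1 : ℤ))
    (hperm : Equiv.swap i j * Equiv.swap a b = Equiv.swap p q * Equiv.swap c e)
    (hval : Valid (fun p => (ent n lam p : ℤ)) L (bmp a.1 b.1 D' (bmp i.1 j.1 D1 t))) :
    ∃ β' : Fin n → ℤ, memP n k d w0I α γ β' ∧
      leB n k d (tmv n i j β) β' ∧ leB n k d (tmv n p q β) β' := by
  have f1 := flow_tmv hf hij hD1
  rw [← tmv_val, ← tmv_val] at hD' h2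
  have f2 := flow_tmv f1 hab hD'
  refine ⟨tmv n a b (tmv n i j β), memP_up hd h0 hnd hr hsup h hab sab f2 hval, ?_, ?_⟩
  · refine Relation.ReflTransGen.single ⟨a, b, hab, sab, ?_, rfl⟩
    unfold gapZ; omega
  · refine Relation.ReflTransGen.single ⟨c, e, hce, sce, ?_, tmv_eq β hperm⟩
    unfold gapZ; omega

theorem ent_antitone {n : ℕ} {lam : Fin n → ℕ} (hlam : IsPartition n lam) :
    Antitone (fun p => (ent n lam p : ℤ)) := by
  intro a b hab
  simp only
  by_cases hb : b < n
  · rw [ent_lt _ hb, ent_lt _ (show a < n by omega)]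
    exact_mod_cast hlam _ _ hab
  · have : ent n lam b = 0 := by unfold ent; rw [dif_neg hb]
    rw [this]; positivity

theorem diamond_half {n k : ℕ} {d : Fin (k + 2) → ℕ} (hd : BlockData n k d)
    {w0I : Equiv.Perm (Fin n)} (h0 : IsLongest n (Iset n k d) w0I)
    {α lam : Fin n → ℕ} (hlam : IsPartition n lam) {γ : Fin (k + 1) → ℕ → ℕ} {L : List ℕ}
    (hnd : L.Nodup) (hr : ∀ m ∈ L, 1 ≤ m ∧ m < n)
    (hns : ∀ m ∈ L, m ∈ Iset n k d →
        ¬ (L.idxOf m < L.idxOf (m - 1) ∧ L.idxOf m < L.idxOf (m + 1)))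
    (hsup : ∀ s, coeff s (keyPoly n α) ≠ 0 ↔
        ∃ t, FlowVec n lam s t ∧ Valid (fun p => (ent n lam p : ℤ)) L t)
    (β : Fin n → ℤ) (hβ : memP n k d w0I α γ β)
    (i j p q : Fin n) (hij : i < j) (hpq : p < q)
    (hsbij : SameBlock n k d i j) (hsbpq : SameBlock n k d p q)
    (hcase : (i = p ∧ j < q) ∨ (j = q ∧ i < p) ∨ (j = p) ∨ (i < p ∧ j ≠ q ∧ j ≠ p))
    (hmem1 : memP n k d w0I α γ (tmv n i j β))
    (hmem2 : memP n k d w0I α γ (tmv n p q β))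
    (hcov1 : β j - gapZ n i j < β i ∧ theta n k d (tmv n i j β) = theta n k d β + 1)
    (hcov2 : β q - gapZ n p q < β p ∧ theta n k d (tmv n p q β) = theta n k d β + 1) :
    ∃ β' : Fin n → ℤ, memP n k d w0I α γ β' ∧
      leB n k d (tmv n i j β) β' ∧ leB n k d (tmv n p q β) β' := by
  have hij' := Fin.lt_def.mp hij
  have hpq' := Fin.lt_def.mp hpq
  obtain ⟨t, hf, hv⟩ := memP_flow hsup hβ
  have hval1 : ∀ {i j : Fin n}, i < j → memP n k d w0I α γ (tmv n i j β) →
      Valid (fun p => (ent n lam p : ℤ)) L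
        (bmp i.1 j.1 ((β i - (i.1 : ℤ)) - (β j - (j.1 : ℤ))) t) := by
    intro i j hij hm
    have hij' := Fin.lt_def.mp hij
    obtain ⟨t1, f1, v1⟩ := memP_flow hsup hm
    have := flow_uniq hr f1 (flow_tmv hf hij rfl) ?_ ?_ v1
    · rw [← this]; exact v1
    · rw [bmp_out (by omega)]
      exact hv.1 0 (fun hh => by have := hr 0 hh; omega)
    · intro m hm
      have := j.2
      rw [bmp_out (by omega)]
      exact hv.1 m (fun hh => by have := hr m hh; omega)
  have v1 := hval1 hij hmem1
  have v2 := hval1 hpq hmem2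
  have c1 := hcov1.1
  have c2 := hcov2.1
  unfold gapZ at c1 c2
  rcases hcase with ⟨hip, hjq⟩ | ⟨hjq, hip⟩ | hjp | ⟨hip, hjq, hjp⟩
  · subst hip
    have hjq' := Fin.lt_def.mp hjq
    have hm := cover_mid hd hij hjq hsbpq β hcov2
    have sjq := sb_trans hd (sb_symm hsbij) hsbpq
    have nij : i ≠ j := hij.ne
    have niq : i ≠ q := hpq.ne
    have njq : j ≠ q := hjq.ne
    refine finish hd h0 hnd hr hsup hmem1 hij hf j q i j hjq hij sjq hsbij rfl
      (D' := (β i - (i.1 : ℤ)) - (β q - (q.1 : ℤ))) ?_ ?_ ?_ ?_ ?_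
    · rw [Equiv.swap_apply_right, Equiv.swap_apply_of_ne_of_ne niq.symm njq.symm]
    · omega
    · rw [Equiv.swap_apply_left, Equiv.swap_apply_of_ne_of_ne nij.symm njq]
      omega
    · rw [Equiv.mul_swap_eq_swap_mul, Equiv.swap_apply_right,
        Equiv.swap_apply_of_ne_of_ne niq.symm njq.symm]
    · refine valid_max v1 v2 ?_
      intro m
      simp only [bmp]
      split_ifs <;> omega
  · subst hjq
    have hip' := Fin.lt_def.mp hip
    have hm := cover_mid hd hip hpq hsbij β hcov1
    have sip := sb_mid hsbij hip.le hpq.le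
    have nij : i ≠ j := hij.ne
    have nip : i ≠ p := hip.ne
    have npj : p ≠ j := hpq.ne
    refine finish hd h0 hnd hr hsup hmem1 hij hf p j i p hpq hip hsbpq sip rfl
      (D' := (β p - (p.1 : ℤ)) - (β i - (i.1 : ℤ))) ?_ ?_ ?_ ?_ ?_
    · rw [Equiv.swap_apply_right, Equiv.swap_apply_of_ne_of_ne nip.symm npj]
    · omega
    · rw [Equiv.swap_apply_left, Equiv.swap_apply_of_ne_of_ne nip nij]
      omega
    · rw [Equiv.mul_swap_eq_swap_mul (Equiv.swap p j), Equiv.swap_apply_left,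
        Equiv.swap_apply_of_ne_of_ne nip nij]
    · refine valid_max v1 v2 ?_
      intro m
      simp only [bmp]
      split_ifs <;> omega
  · subst hjp
    have siq := sb_trans hd hsbij hsbpq
    have nij : i ≠ j := hij.ne
    have niq : i ≠ q := (hij.trans hpq).ne
    have njq : j ≠ q := hpq.ne
    have hiq : i < q := hij.trans hpq
    rcases valid_chain hij' hpq' (by omega) (by omega)
      (fun e a1 a2 a3 => hns e a3 (sb_edge hd siq a1 a2)) hv v1 v2 with hV | hV
    · refine finish hd h0 hnd hr hsup hmem1 hij hf i q i j hiq hij siq hsbij rfl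
        (D' := (β j - (j.1 : ℤ)) - (β q - (q.1 : ℤ))) ?_ ?_ ?_ ?_ hV
      · rw [Equiv.swap_apply_left, Equiv.swap_apply_of_ne_of_ne niq.symm njq.symm]
      · omega
      · rw [Equiv.swap_apply_left, Equiv.swap_apply_of_ne_of_ne nij niq]
        omega
      · rw [Equiv.mul_swap_eq_swap_mul, Equiv.swap_apply_left,
          Equiv.swap_apply_of_ne_of_ne niq.symm njq.symm]
    · refine finish hd h0 hnd hr hsup hmem1 hij hf j q i q hpq hiq hsbpq siq rfl
        (D' := (β i - (i.1 : ℤ)) - (β q - (q.1 : ℤ))) ?_ ?_ ?_ ?_ ?_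
      · rw [Equiv.swap_apply_right, Equiv.swap_apply_of_ne_of_ne niq.symm njq.symm]
      · omega
      · rw [Equiv.swap_apply_right, Equiv.swap_apply_of_ne_of_ne nij niq]
        omega
      · rw [Equiv.mul_swap_eq_swap_mul (Equiv.swap j q), Equiv.swap_apply_right,
          Equiv.swap_apply_of_ne_of_ne nij niq]
      · convert hV using 1
        funext m
        simp only [bmp]
        split_ifs <;> omega
  · have hip' := Fin.lt_def.mp hip
    have nip : i ≠ p := hip.ne
    have niq : i ≠ q := (hip.trans hpq).ne
    refine finish hd h0 hnd hr hsup hmem1 hij hf p q i j hpq hij hsbpq hsbij rfl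
      (D' := (β p - (p.1 : ℤ)) - (β q - (q.1 : ℤ))) ?_ ?_ ?_ ?_ ?_
    · rw [Equiv.swap_apply_of_ne_of_ne nip.symm (Ne.symm hjp),
        Equiv.swap_apply_of_ne_of_ne niq.symm (Ne.symm hjq)]
    · omega
    · rw [Equiv.swap_apply_of_ne_of_ne hjp hjq, Equiv.swap_apply_of_ne_of_ne nip niq]
      omega
    · rw [Equiv.mul_swap_eq_swap_mul, Equiv.swap_apply_of_ne_of_ne nip.symm (Ne.symm hjp),
        Equiv.swap_apply_of_ne_of_ne niq.symm (Ne.symm hjq)]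
    · refine valid_distinct (ent_antitone hlam) hip' (fun h => hjq (Fin.ext h)) (by omega) (by omega)
        ?_ ?_ ?_ hv v1 v2
      · rintro e (⟨a1, a2⟩ | ⟨a1, a2⟩) a3
        · exact hns e a3 (sb_edge hd hsbij a1 a2)
        · exact hns e a3 (sb_edge hd hsbpq a1 a2)
      · rw [hf i, hf j]; ring
      · rw [hf p, hf q]; ring

end PartF

end LSS

namespace LSS

/-- Theorem 5.4, Diamond property: if `t_{ij}β` and `t_{pq}β` both lie
in `P_{cλ,γ}` and both cover `β`, then they have a common upper bound in `P_{cλ,γ}`. -/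
theorem stmt12 (n k : ℕ) (d : Fin (k + 2) → ℕ) (hd : BlockData n k d)
    (c w0I : Equiv.Perm (Fin n)) (hc : IsStdCox n c)
    (h0 : IsLongest n (Iset n k d) w0I)
    (hlen : len n (w0I * c) = len n w0I + len n c)
    (hJ : Iset n k d ⊆ Descents n (w0I * c))
    (lam : Fin n → ℕ) (hlam : IsPartition n lam)
    (γ : Fin (k + 1) → ℕ → ℕ) (hγ : ParD k d γ)
    (β : Fin n → ℤ) (hβ : memP n k d w0I (pact n c lam) γ β)
    (i j p q : Fin n) (hij : i < j) (hpq : p < q)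
    (hsbij : SameBlock n k d i j) (hsbpq : SameBlock n k d p q)
    (hne : (i, j) ≠ (p, q))
    (hmem1 : memP n k d w0I (pact n c lam) γ (tmv n i j β))
    (hmem2 : memP n k d w0I (pact n c lam) γ (tmv n p q β))
    (hcov1 : β j - gapZ n i j < β i ∧ theta n k d (tmv n i j β) = theta n k d β + 1)
    (hcov2 : β q - gapZ n p q < β p ∧ theta n k d (tmv n p q β) = theta n k d β + 1) :
    ∃ β' : Fin n → ℤ, memP n k d w0I (pact n c lam) γ β' ∧
      leB n k d (tmv n i j β) β' ∧ leB n k d (tmv n p q β) β' := by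
  obtain ⟨L, hnd, hr, hns, hsup⟩ := key_flow hc h0 hlen lam hlam
  by_cases hcase : (i = p ∧ j < q) ∨ (j = q ∧ i < p) ∨ (j = p) ∨ (i < p ∧ j ≠ q ∧ j ≠ p)
  · exact diamond_half hd h0 hlam hnd hr hns hsup β hβ i j p q hij hpq hsbij hsbpq hcase
      hmem1 hmem2 hcov1 hcov2
  · have hcase2 : (p = i ∧ q < j) ∨ (q = j ∧ p < i) ∨ (q = i) ∨ (p < i ∧ q ≠ j ∧ q ≠ i) := by
      rw [ne_eq, Prod.mk.injEq] at hne
      simp only [Fin.ext_iff, Fin.lt_def, ne_eq] at *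
      omega
    obtain ⟨β', u, v, w⟩ := diamond_half hd h0 hlam hnd hr hns hsup β hβ p q i j hpq hij
      hsbpq hsbij hcase2 hmem2 hmem1 hcov2 hcov1
    exact ⟨β', u, w, v⟩

end LSS
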